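/- Assume the Riemann Hypothesis. Then for every α > 0 and every positive integer j, ∑_{0<γ≤T} e^{2πi j α γ} = O(T) as T → ∞, where the sum runs over the imaginary parts γ of the nontrivial zeros of the Riemann zeta function with 0 < γ ≤ T, counted with multiplicity; consequently, listing these imaginary parts in increasing order as γ₁ ≤ γ₂ ≤ … (with multiplicity), the sequence of fractional parts {αγ_n} is uniformly distributed in [0,1). -/

import Mathlib

open Filter MeasureTheory Real Complex Set

open Classical in
/-- Multiplicity of a point as a zero of the Riemann zeta function. -/
noncomputable def zetaZeroMult (ρ : ℂ) : ℕ :=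
  if h : AnalyticAt ℂ riemannZeta ρ then (analyticOrderAt riemannZeta ρ).toNat else 0

/-- Nontrivial zeros with imaginary part in `(0, T]`. -/
def zetaZerosUpTo (T : ℝ) : Set ℂ :=
  {ρ : ℂ | riemannZeta ρ = 0 ∧ 0 < ρ.re ∧ ρ.re < 1 ∧ 0 < ρ.im ∧ ρ.im ≤ T}

/-- `N(T)`: number of nontrivial zeros with `0 < γ ≤ T`, counted with multiplicity. -/
noncomputable def zetaN (T : ℝ) : ℕ := ∑ᶠ ρ ∈ zetaZerosUpTo T, zetaZeroMult ρ

/-- Explicit density `g` when `α = a log p / (2 π q)`. -/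
noncomputable def gPAQ (p a q : ℕ) (t : ℝ) : ℝ :=
  -(((p : ℝ) ^ ((a : ℝ) / 2) * Real.cos (2 * π * q * t) - 1) * Real.log p) /
    (π * ((p : ℝ) ^ (a : ℝ) - 2 * (p : ℝ) ^ ((a : ℝ) / 2) * Real.cos (2 * π * q * t) + 1))

/-- `α` has the special form `a log p / (2 π q)` with `p` prime, `a, q` coprime positive. -/
def IsSpecialForm (α : ℝ) (p a q : ℕ) : Prop :=
  p.Prime ∧ 0 < a ∧ 0 < q ∧ Nat.Coprime a q ∧ α = a * Real.log p / (2 * π * q)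

/-- `g` is the density `g_α` associated with `α`. -/
def IsDensityOf (α : ℝ) (g : ℝ → ℝ) : Prop :=
  (∀ p a q : ℕ, IsSpecialForm α p a q → g = gPAQ p a q) ∧
    ((¬ ∃ p a q : ℕ, IsSpecialForm α p a q) → g = 0)

/-- Sum of `h(αγ)` over zeros with `0 < γ ≤ T`, with multiplicity; `h` is `1`-periodic so this
equals the sum of `h({αγ})`. -/
noncomputable def zetaZeroSum (α : ℝ) (h : ℝ → ℂ) (T : ℝ) : ℂ :=
  ∑ᶠ ρ ∈ zetaZerosUpTo T, (zetaZeroMult ρ : ℂ) * h (α * ρ.im)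

/-- `h` is (a lift of) an absolutely continuous function on `𝕋 = ℝ/ℤ`, with derivative `h'`. -/
def IsAbsContTorus (h h' : ℝ → ℂ) : Prop :=
  Function.Periodic h 1 ∧ Function.Periodic h' 1 ∧
    (∀ a b : ℝ, IntervalIntegrable h' volume a b) ∧
    ∀ y : ℝ, h y = h 0 + ∫ t in (0:ℝ)..y, h' t

/-- `L¹` modulus of continuity on the torus. -/
noncomputable def modCont (f : ℝ → ℂ) (δ : ℝ) : ℝ :=
  sSup ((fun u => ∫ t in (0:ℝ)..1, ‖f (t + u) - f t‖) '' Set.Icc (-δ) δ)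

/-- `M_α(y;T)`. -/
noncomputable def Mfun (α y T : ℝ) : ℝ :=
  (1 / T) * (∑ᶠ ρ ∈ {ρ : ℂ | riemannZeta ρ = 0 ∧ 0 < ρ.re ∧ ρ.re < 1 ∧ 0 < ρ.im ∧ ρ.im ≤ T ∧
      Int.fract (α * ρ.im) < y}, (zetaZeroMult ρ : ℝ)) - y * (zetaN T) / T

/-- Normalized discrepancy `D*_α(T)`. -/
noncomputable def Dstar (α T : ℝ) : ℝ :=
  sSup ((fun y => (T / (zetaN T)) * |Mfun α y T|) '' Set.Icc (0:ℝ) 1)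


namespace Rad
open Topology

noncomputable def fracFn (t : ℝ) : ℂ := (Ioi (1:ℝ)).indicator (fun t => ((Int.fract t : ℝ) : ℂ)) t

lemma fracFn_norm_le (t : ℝ) : ‖fracFn t‖ ≤ 1 := by
  unfold fracFn
  by_cases h : t ∈ Ioi (1:ℝ)
  · rw [indicator_of_mem h, Complex.norm_real, Real.norm_eq_abs, abs_of_nonneg (Int.fract_nonneg _)]
    exact (Int.fract_lt_one _).le
  · rw [indicator_of_notMem h]; simp

lemma fracFn_meas : Measurable fracFn := by
  unfold fracFn
  exact (Complex.measurable_ofReal.comp measurable_fract).indicator measurableSet_Ioi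

noncomputable def zJ (s : ℂ) : ℂ := mellin fracFn (-s)

lemma zJ_eq (s : ℂ) : zJ s = ∫ t in Ioi (1:ℝ), (t:ℂ) ^ (-s-1) * ((Int.fract t : ℝ) : ℂ) := by
  unfold zJ mellin
  have : ∀ t : ℝ, (t:ℂ) ^ (-s-1) • fracFn t
      = (Ioi (1:ℝ)).indicator (fun t => (t:ℂ) ^ (-s-1) * ((Int.fract t : ℝ) : ℂ)) t := by
    intro t
    unfold fracFn
    by_cases h : t ∈ Ioi (1:ℝ)
    · rw [indicator_of_mem h, indicator_of_mem h, smul_eq_mul]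
    · rw [indicator_of_notMem h, indicator_of_notMem h]; simp
  simp_rw [this]
  rw [setIntegral_indicator measurableSet_Ioi]
  congr 2
  ext t
  simp only [mem_inter_iff, mem_Ioi]
  constructor
  · exact fun h => h.2
  · exact fun h => ⟨by linarith, h⟩

lemma zJ_diff {s : ℂ} (hs : 0 < s.re) : DifferentiableAt ℂ zJ s := by
  have h1 : DifferentiableAt ℂ (mellin fracFn) (-s) := by
    apply mellin_differentiableAt_of_isBigO_rpow (a := 0) (b := -s.re - 1)
    · apply MeasureTheory.LocallyIntegrable.locallyIntegrableOn
      refine (locallyIntegrable_const (1:ℝ)).mono fracFn_meas.aestronglyMeasurable ?_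
      exact ae_of_all _ (fun t => by simpa using fracFn_norm_le t)
    · simp only [neg_zero, Real.rpow_zero]
      exact Asymptotics.isBigO_of_le _ (fun t => by simpa using fracFn_norm_le t)
    · simpa using hs
    · have : fracFn =ᶠ[𝓝[>] 0] fun _ => 0 := by
        have : Ioo (0:ℝ) 1 ∈ 𝓝[>] (0:ℝ) := Ioo_mem_nhdsGT one_pos
        filter_upwards [this] with t ht
        unfold fracFn
        rw [indicator_of_notMem]
        simpa using ht.2.le
      exact this.trans_isBigO (Asymptotics.isBigO_zero _ _)
    · simp
  exact h1.comp s differentiableAt_id.neg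

lemma zJ_norm {s : ℂ} (hs : 0 < s.re) : ‖zJ s‖ ≤ 1 / s.re := by
  rw [zJ_eq]
  have hint := integral_Ioi_rpow_of_lt (a := -s.re-1) (by linarith) one_pos
  calc _ ≤ ∫ t in Ioi (1:ℝ), t ^ (-s.re-1) := by
        apply norm_integral_le_of_norm_le (integrableOn_Ioi_rpow_of_lt (by linarith) one_pos)
        refine (ae_restrict_iff' measurableSet_Ioi).mpr (ae_of_all _ fun t ht => ?_)
        have ht0 : (0:ℝ) < t := lt_trans one_pos ht
        rw [norm_mul, Complex.norm_cpow_eq_rpow_re_of_pos ht0, Complex.norm_real,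
          Real.norm_eq_abs, abs_of_nonneg (Int.fract_nonneg _)]
        simp only [sub_re, neg_re, one_re]
        exact mul_le_of_le_one_right (by positivity) (Int.fract_lt_one _).le
    _ = 1 / s.re := by
        rw [hint]; simp

lemma zeta_eq_of_one_lt {s : ℂ} (hs : 1 < s.re) : riemannZeta s = s / (s-1) - s * zJ s := by
  have hs1 : s - 1 ≠ 0 := by
    intro h; have := congrArg Complex.re h; simp at this; linarith
  have h := LSeries_eq_mul_integral_of_nonneg (fun _ => (1:ℝ)) (r := 1) zero_le_one hs
    (by simp only [Finset.sum_const, Nat.card_Icc, Real.rpow_one]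
        exact Asymptotics.isBigO_of_le _ (fun n => by simp)) (fun _ => zero_le_one)
  have h2 : LSeries (fun n : ℕ => (((fun _ => (1:ℝ)) n : ℝ) : ℂ)) s = riemannZeta s := by
    rw [← LSeries_one_eq_riemannZeta hs]
    apply congrFun; congr 1
  rw [h2] at h
  rw [h, zJ_eq]
  have hI1 : IntegrableOn (fun t : ℝ => (t:ℂ) ^ (-s)) (Ioi 1) :=
    integrableOn_Ioi_cpow_of_lt (by simpa using hs) one_pos
  have hI2 : IntegrableOn (fun t : ℝ => (t:ℂ) ^ (-s-1) * ((Int.fract t : ℝ) : ℂ)) (Ioi 1) := by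
    have h0 : IntegrableOn (fun t : ℝ => (t:ℂ) ^ (-s-1)) (Ioi 1) :=
      integrableOn_Ioi_cpow_of_lt (by simp; linarith) one_pos
    refine h0.mul_bdd (c := 1) ?_ ?_
    · exact (Complex.measurable_ofReal.comp measurable_fract).aestronglyMeasurable
    · refine ae_of_all _ fun t => ?_
      rw [Complex.norm_real, Real.norm_eq_abs, abs_of_nonneg (Int.fract_nonneg _)]
      exact (Int.fract_lt_one _).le
  have key : ∫ t in Ioi (1:ℝ), (∑ k ∈ Finset.Icc 1 ⌊t⌋₊, ((1:ℝ) : ℂ)) * (t:ℂ) ^ (-(s + 1))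
     = (∫ t in Ioi (1:ℝ), (t:ℂ) ^ (-s)) -
      ∫ t in Ioi (1:ℝ), (t:ℂ) ^ (-s-1) * ((Int.fract t : ℝ) : ℂ) := by
    rw [← integral_sub hI1 hI2]
    apply setIntegral_congr_fun measurableSet_Ioi
    intro t ht
    have ht0 : (0:ℝ) < t := lt_trans one_pos ht
    have htc : (t:ℂ) ≠ 0 := by exact_mod_cast ht0.ne'
    have e1 : (t:ℂ) ^ (-s) = (t:ℂ) ^ (-s-1) * t := by
      rw [Complex.cpow_sub _ _ htc, Complex.cpow_one]; field_simp
    have e2 : ((⌊t⌋₊ : ℕ) : ℂ) = (t:ℂ) - ((Int.fract t : ℝ) : ℂ) := by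
      have : ((⌊t⌋₊ : ℕ) : ℝ) = t - Int.fract t := by
        rw [natCast_floor_eq_intCast_floor ht0.le, Int.self_sub_fract]
      exact_mod_cast congrArg (fun x : ℝ => (x:ℂ)) this
    simp only [ofReal_one, Finset.sum_const, Nat.card_Icc, Nat.add_sub_cancel, nsmul_eq_mul, mul_one]
    rw [e1, e2, show -(s+1) = -s-1 by ring]; ring
  have key2 := integral_Ioi_cpow_of_lt (a := -s) (by simpa using hs) one_pos
  rw [key, key2]
  have : -s + 1 ≠ 0 := by intro h; apply hs1; linear_combination -h
  simp only [ofReal_one, one_cpow]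
  field_simp
  ring

lemma zeta_eq {s : ℂ} (hs : 0 < s.re) (hs1 : s ≠ 1) : riemannZeta s = s / (s-1) - s * zJ s := by
  have hU : IsOpen {s : ℂ | 0 < s.re} := isOpen_lt continuous_const Complex.continuous_re
  have hf : AnalyticOnNhd ℂ riemannZeta₁ {s : ℂ | 0 < s.re} := by
    apply DifferentiableOn.analyticOnNhd _ hU
    exact differentiable_riemannZeta₁.differentiableOn
  have hg : AnalyticOnNhd ℂ (fun s => s - s * (s-1) * zJ s) {s : ℂ | 0 < s.re} := by
    apply DifferentiableOn.analyticOnNhd _ hU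
    intro z hz
    have := zJ_diff hz
    apply DifferentiableAt.differentiableWithinAt
    fun_prop
  have hc : IsPreconnected {s : ℂ | 0 < s.re} := (convex_halfSpace_re_gt 0).isPreconnected
  have heq := hf.eqOn_of_preconnected_of_eventuallyEq hg hc (z₀ := 2) (by simp) (by
    have : {s : ℂ | 1 < s.re} ∈ 𝓝 (2:ℂ) :=
      (isOpen_lt continuous_const Complex.continuous_re).mem_nhds (by simp)
    filter_upwards [this] with z hz
    have hz' : 1 < z.re := hz
    have hz1 : z - 1 ≠ 0 := by
      intro h; have := congrArg Complex.re h; simp at this; linarith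
    have h1 := zeta_eq_of_one_lt hz'
    rw [riemannZeta_eq_inv_sub_mul (sub_ne_zero.mp hz1)] at h1
    field_simp at h1
    linear_combination h1)
  have h3 := heq hs
  simp only at h3
  have := sub_ne_zero.mpr hs1
  rw [riemannZeta_eq_inv_sub_mul hs1, h3]
  field_simp

/-- polynomial growth of zeta -/
lemma zeta_growth {s : ℂ} (hs : 1/20 ≤ s.re) (hi : 1 ≤ s.im) : ‖riemannZeta s‖ ≤ 21 * ‖s‖ := by
  have h1 : s ≠ 1 := by
    intro h; rw [h] at hi; simp at hi; linarith
  rw [zeta_eq (by linarith) h1]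
  have hn : 1 ≤ ‖s - 1‖ := by
    calc (1:ℝ) ≤ |(s-1).im| := by simp; exact hi.trans (le_abs_self _)
      _ ≤ _ := Complex.abs_im_le_norm _
  have hJ : ‖zJ s‖ ≤ 20 := (zJ_norm (by linarith)).trans (by
    rw [div_le_iff₀ (by linarith)]; linarith)
  calc _ ≤ ‖s / (s-1)‖ + ‖s * zJ s‖ := norm_sub_le _ _
    _ ≤ ‖s‖ + ‖s‖ * 20 := by
      rw [norm_div, norm_mul]
      gcongr
      exact div_le_self (norm_nonneg _) hn
    _ = _ := by ring
end Rad


namespace Rad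
open Topology

lemma gammaSeq_norm_le {z : ℂ} (hz : 0 < z.re) {n : ℕ} (hn : n ≠ 0) :
    ‖Complex.GammaSeq z n‖ ≤ Real.Gamma z.re := by
  rw [Complex.GammaSeq_eq_approx_Gamma_integral hz hn, Real.Gamma_eq_integral hz,
    intervalIntegral.integral_of_le (Nat.cast_nonneg n)]
  have hI := Real.GammaIntegral_convergent hz
  calc _ ≤ ∫ x in Ioc (0:ℝ) n, Real.exp (-x) * x ^ (z.re - 1) := by
        apply norm_integral_le_of_norm_le (hI.mono_set Ioc_subset_Ioi_self)
        refine (ae_restrict_iff' measurableSet_Ioc).mpr (ae_of_all _ fun t ht => ?_)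
        have hn' : (0:ℝ) < n := by positivity
        have h1 : 0 ≤ 1 - t / n := by
          rw [sub_nonneg, div_le_one hn']; exact ht.2
        rw [norm_mul, Complex.norm_cpow_eq_rpow_re_of_pos ht.1, Complex.norm_real,
          Real.norm_eq_abs, abs_of_nonneg (by positivity)]
        simp only [sub_re, one_re]
        have := Real.rpow_nonneg ht.1.le (z.re - 1)
        gcongr
        exact Real.one_sub_div_pow_le_exp_neg ht.2
    _ ≤ _ := by
        apply setIntegral_mono_set hI
        · refine (ae_restrict_iff' measurableSet_Ioi).mpr (ae_of_all _ fun t ht => ?_)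
          have ht' : (0:ℝ) < t := ht
          positivity
        · exact Ioc_subset_Ioi_self.eventuallyLE

lemma add_nat_ne {z : ℂ} (hz : 0 < z.re) (j : ℕ) : z + j ≠ 0 := by
  intro h
  have := congrArg Complex.re h
  simp at this
  have : (0:ℝ) ≤ j := Nat.cast_nonneg j
  linarith

lemma ne_neg_nat {z : ℂ} (hz : 0 < z.re) (j : ℕ) : z ≠ -j := by
  intro h
  exact add_nat_ne hz j (by rw [h]; ring)

lemma gammaSeq_diff {n : ℕ} (hn : n ≠ 0) {z : ℂ} (hz : 0 < z.re) :
    DifferentiableAt ℂ (fun z => Complex.GammaSeq z n) z := by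
  unfold Complex.GammaSeq
  have hn' : (n:ℂ) ≠ 0 := by exact_mod_cast hn
  apply DifferentiableAt.div
  · apply DifferentiableAt.mul_const
    exact differentiableAt_id.const_cpow (Or.inl hn')
  · apply DifferentiableAt.fun_finsetProd
    intro i _
    fun_prop
  · exact Finset.prod_ne_zero_iff.mpr fun j _ => add_nat_ne hz j

lemma gammaSeq_logDeriv {n : ℕ} (hn : n ≠ 0) {z : ℂ} (hz : 0 < z.re) :
    logDeriv (fun z => Complex.GammaSeq z n) z =
      Real.log n - ∑ j ∈ Finset.range (n+1), 1 / (z + j) := by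
  unfold Complex.GammaSeq
  have hn' : (n:ℂ) ≠ 0 := by exact_mod_cast hn
  have hp : ∏ j ∈ Finset.range (n+1), (z + j) ≠ 0 :=
    Finset.prod_ne_zero_iff.mpr fun j _ => add_nat_ne hz j
  have hd1 : DifferentiableAt ℂ (fun z => (n:ℂ)^z * (n.factorial:ℂ)) z :=
    (differentiableAt_id.const_cpow (Or.inl hn')).mul_const _
  have hne : (n:ℂ)^z * (n.factorial:ℂ) ≠ 0 := by
    apply mul_ne_zero
    · rw [Complex.cpow_def_of_ne_zero hn']; exact Complex.exp_ne_zero _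
    · exact_mod_cast n.factorial_ne_zero
  rw [logDeriv_div z hne hp hd1 (by
    apply DifferentiableAt.fun_finsetProd
    intro i _
    fun_prop)]
  congr 1
  · rw [logDeriv_mul_const z _ (by exact_mod_cast n.factorial_ne_zero), logDeriv_apply]
    have := (hasDerivAt_id z).const_cpow (c := (n:ℂ)) (Or.inl hn')
    simp only [id] at this
    rw [this.deriv, Complex.ofReal_log (Nat.cast_nonneg n)]
    have : (n:ℂ)^z ≠ 0 := by
      rw [Complex.cpow_def_of_ne_zero hn']; exact Complex.exp_ne_zero _
    field_simp
    simp
  · rw [logDeriv_prod (fun j _ => add_nat_ne hz j) (by intro i _; fun_prop)]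
    apply Finset.sum_congr rfl
    intro j _
    rw [logDeriv_apply]
    simp

lemma gammaSeq_deriv_tendsto {s : ℂ} (hs : 1/2 ≤ s.re) :
    Tendsto (fun n : ℕ => deriv (fun z => Complex.GammaSeq z n) s) atTop
      (𝓝 (deriv Complex.Gamma s)) := by
  have hU : IsOpen {z : ℂ | 0 < z.re} := isOpen_lt continuous_const Complex.continuous_re
  have hball : Metric.closedBall s (1/4) ⊆ {z : ℂ | 0 < z.re} := by
    intro z hz
    have h1 : |(z - s).re| ≤ 1/4 := (Complex.abs_re_le_norm _).trans (by
      simpa [dist_eq_norm] using hz)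
    have := (abs_le.mp h1).1
    simp only [sub_re] at this
    simp only [mem_setOf_eq]
    linarith
  have e1 : ∀ n : ℕ, n ≠ 0 → deriv (fun z => Complex.GammaSeq z n) s
      = cderiv (1/4) (fun z => Complex.GammaSeq z n) s := by
    intro n hn
    rw [cderiv_eq_deriv hU (fun z hz => (gammaSeq_diff hn hz).differentiableWithinAt)
      (by norm_num) hball]
  have hG : DifferentiableOn ℂ Complex.Gamma {z : ℂ | 0 < z.re} := fun z hz =>
      (Complex.differentiableAt_Gamma z (ne_neg_nat hz)).differentiableWithinAt
  have e2 : deriv Complex.Gamma s = cderiv (1/4) Complex.Gamma s := by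
    rw [cderiv_eq_deriv hU hG (by norm_num) hball]
  have hmem : ∀ θ : ℝ, 0 < (circleMap s (1/4) θ).re := fun θ =>
    hball (circleMap_mem_closedBall _ (by norm_num) _)
  have hcont : Continuous fun θ : ℝ => Real.Gamma (circleMap s (1/4) θ).re := by
    rw [continuous_iff_continuousAt]
    intro θ
    have h1 : ContinuousAt Real.Gamma (circleMap s (1/4) θ).re := by
      apply (Real.differentiableAt_Gamma _).continuousAt
      intro m
      have := hmem θ
      have : (0:ℝ) ≤ m := Nat.cast_nonneg m
      intro h; linarith
    exact ContinuousAt.comp (f := fun θ : ℝ => (circleMap s (1/4) θ).re) h1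
      (Complex.continuous_re.comp (continuous_circleMap _ _)).continuousAt
  have hr : ∀ θ : ℝ, ‖circleMap s (1/4) θ - s‖ = 1/4 := by
    intro θ; simp [circleMap]
  rw [e2]
  refine Tendsto.congr' (f₁ := fun n : ℕ => cderiv (1/4) (fun z => Complex.GammaSeq z n) s)
    ?_ ?_
  · filter_upwards [eventually_ne_atTop 0] with n hn
    exact (e1 n hn).symm
  · unfold cderiv
    apply Tendsto.const_smul
    unfold circleIntegral
    apply intervalIntegral.tendsto_integral_filter_of_dominated_convergence
      (bound := fun θ => 4 * Real.Gamma (circleMap s (1/4) θ).re)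
    · filter_upwards [eventually_ne_atTop 0] with n hn
      apply Continuous.aestronglyMeasurable
      have hc : Continuous (fun θ : ℝ => Complex.GammaSeq (circleMap s (1/4) θ) n) := by
        rw [continuous_iff_continuousAt]
        intro θ
        exact ContinuousAt.comp (f := fun θ : ℝ => circleMap s (1/4) θ)
          (g := fun z => Complex.GammaSeq z n) (gammaSeq_diff hn (hmem θ)).continuousAt
          (continuous_circleMap _ _).continuousAt
      have hd : Continuous (fun θ : ℝ => deriv (circleMap s (1/4)) θ) := by
        simp only [deriv_circleMap]
        exact (continuous_circleMap 0 _).mul continuous_const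
      refine Continuous.fun_smul hd (Continuous.fun_smul ?_ hc)
      apply Continuous.inv₀
      · exact ((continuous_circleMap _ _).sub continuous_const).pow 2
      · intro θ h
        have h2 := hr θ
        have h3 : circleMap s (1/4) θ - s = 0 := by simpa using h
        rw [h3] at h2
        norm_num at h2
    · filter_upwards [eventually_ne_atTop 0] with n hn
      refine ae_of_all _ fun θ _ => ?_
      rw [norm_smul, norm_smul, norm_inv, norm_pow, hr θ]
      have : ‖deriv (circleMap s (1/4)) θ‖ = 1/4 := by
        simp [deriv_circleMap]
      rw [this]
      have := gammaSeq_norm_le (hmem θ) hn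
      norm_num
      linarith
    · exact (hcont.const_smul (4:ℝ)).intervalIntegrable _ _
    · refine ae_of_all _ fun θ _ => ?_
      apply Tendsto.const_smul
      apply Tendsto.const_smul
      exact Complex.GammaSeq_tendsto_Gamma _

lemma digamma_tendsto {s : ℂ} (hs : 1/2 ≤ s.re) :
    Tendsto (fun n : ℕ => ((Real.log n : ℝ) : ℂ) - ∑ j ∈ Finset.range (n+1), 1 / (s + j)) atTop
      (𝓝 (logDeriv Complex.Gamma s)) := by
  have h0 : 0 < s.re := by linarith
  have h1 := (gammaSeq_deriv_tendsto hs).div (Complex.GammaSeq_tendsto_Gamma s)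
    (Complex.Gamma_ne_zero_of_re_pos h0)
  refine h1.congr' ?_
  filter_upwards [eventually_ne_atTop 0] with n hn
  rw [← gammaSeq_logDeriv hn h0, logDeriv_apply]
  rfl

lemma log_step {w : ℂ} (hw : 0 < w.re) :
    ‖Complex.log (w+1) - Complex.log w - 1/w‖ ≤ 1 / w.re^2 := by
  have hre : ∀ u ∈ Icc (0:ℝ) 1, 0 < (w + u).re := by
    intro u hu; simp; linarith [hu.1]
  have hw0 : w ≠ 0 := by intro h; rw [h] at hw; simp at hw
  have key := norm_image_sub_le_of_norm_deriv_le_segment_01' (E := ℂ)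
    (f := fun u : ℝ => Complex.log (w + u) - u / w) (f' := fun u : ℝ => 1 / (w+u) - 1/w)
    (C := 1 / w.re^2) (by
      intro u hu
      apply HasDerivAt.hasDerivWithinAt
      have h1 : HasDerivAt (fun u : ℝ => w + (u:ℂ)) 1 u := by
        simpa using (Complex.ofRealCLM.hasDerivAt (x := u)).const_add w
      have h2 := h1.clog_real (Or.inl (hre u hu))
      have h3 : HasDerivAt (fun u : ℝ => (u:ℂ)/w) (1/w) u := by
        simpa using (Complex.ofRealCLM.hasDerivAt (x := u)).div_const w
      exact h2.sub h3) (by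
      intro u hu
      have hu' : u ∈ Icc (0:ℝ) 1 := ⟨hu.1, hu.2.le⟩
      have hne : w + u ≠ 0 := by
        intro h; have := hre u hu'; rw [h] at this; simp at this
      have : 1/(w+u) - 1/w = -u / (w * (w+u)) := by field_simp; ring
      rw [this, norm_div, norm_mul, norm_neg, Complex.norm_real, Real.norm_eq_abs,
        abs_of_nonneg hu.1]
      have h1 : w.re ≤ ‖w‖ := Complex.re_le_norm w
      have h2 : w.re ≤ ‖w+u‖ := by
        refine le_trans ?_ (Complex.re_le_norm _)
        simp; exact hu.1
      rw [pow_two]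
      gcongr
      exact hu.2.le)
  simpa [sub_right_comm] using key

noncomputable def dgC : ℝ := ∑' k : ℕ, 1 / ((k:ℝ) + 1/2)^2

lemma dg_summable : Summable fun k : ℕ => 1 / ((k:ℝ) + 1/2)^2 := by
  have h := (Real.summable_one_div_nat_pow (p := 2)).mpr (by norm_num)
  rw [← summable_nat_add_iff 1]
  refine Summable.of_nonneg_of_le (fun k => by positivity) (fun k => ?_)
    ((summable_nat_add_iff 1).mpr h)
  push_cast
  apply one_div_le_one_div_of_le (by positivity)
  apply pow_le_pow_left₀ (by positivity)
  linarith

lemma digamma_bound {s : ℂ} (hs : 1/2 ≤ s.re) :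
    ‖logDeriv Complex.Gamma s - Complex.log s‖ ≤ dgC := by
  have h0 : 0 < s.re := by linarith
  have hlim : Tendsto (fun n : ℕ => Complex.log (s + n + 1) - ((Real.log n : ℝ):ℂ)) atTop (𝓝 0) := by
    have h1 : Tendsto (fun n : ℕ => 1 + (s+1)/(n:ℂ)) atTop (𝓝 (1 + 0)) :=
      tendsto_const_nhds.add (tendsto_const_div_atTop_nhds_zero_nat _)
    rw [add_zero] at h1
    have h2 : Tendsto (fun n : ℕ => Complex.log (1 + (s+1)/(n:ℂ))) atTop (𝓝 (Complex.log 1)) :=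
      (continuousAt_clog (by simp)).tendsto.comp h1
    rw [Complex.log_one] at h2
    refine h2.congr' ?_
    filter_upwards [eventually_ne_atTop 0] with n hn
    have hn' : (0:ℝ) < n := by positivity
    have hnc : (n:ℂ) ≠ 0 := by exact_mod_cast hn
    have e : s + n + 1 = ((n:ℝ):ℂ) * (1 + (s+1)/(n:ℂ)) := by
      push_cast; field_simp; ring
    have hx : (1 + (s+1)/(n:ℂ)) ≠ 0 := by
      intro h
      rw [h, mul_zero] at e
      have := congrArg Complex.re e
      simp at this
      linarith
    rw [e, Complex.log_ofReal_mul hn' hx]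
    ring
  have h2 := (digamma_tendsto hs).add hlim
  rw [add_zero] at h2
  have h3 := (h2.sub_const (Complex.log s)).norm
  refine le_of_tendsto h3 (Eventually.of_forall fun n => ?_)
  have tel : Complex.log (s + n + 1) - Complex.log s
      = ∑ j ∈ Finset.range (n+1), (Complex.log (s + j + 1) - Complex.log (s+j)) := by
    have := Finset.sum_range_sub (fun j : ℕ => Complex.log (s + j)) (n+1)
    push_cast at this
    simp only [← add_assoc, add_zero] at this
    exact this.symm
  have e : ((Real.log n : ℝ) : ℂ) - ∑ j ∈ Finset.range (n+1), 1 / (s + j)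
      + (Complex.log (s + n + 1) - ((Real.log n : ℝ):ℂ)) - Complex.log s
      = ∑ j ∈ Finset.range (n+1), (Complex.log (s + j + 1) - Complex.log (s+j) - 1/(s+j)) := by
    rw [Finset.sum_sub_distrib, ← tel]; ring
  rw [e]
  calc _ ≤ ∑ j ∈ Finset.range (n+1), ‖Complex.log (s + j + 1) - Complex.log (s+j) - 1/(s+j)‖ :=
        norm_sum_le _ _
    _ ≤ ∑ j ∈ Finset.range (n+1), 1 / ((j:ℝ) + 1/2)^2 := by
        apply Finset.sum_le_sum
        intro j _
        have hj : (0:ℝ) ≤ j := Nat.cast_nonneg j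
        refine (log_step (w := s + j) (by simp; linarith)).trans ?_
        simp only [add_re, natCast_re]
        exact one_div_le_one_div_of_le (by positivity) (pow_le_pow_left₀ (by positivity) (by linarith) 2)
    _ ≤ dgC := dg_summable.sum_le_tsum _ (fun _ _ => by positivity)
end Rad

namespace Rad
open Topology

lemma tan_bound {z : ℂ} (hz : 1 ≤ |z.im|) : Complex.cos z ≠ 0 ∧ ‖Complex.tan z‖ ≤ 2 := by
  have hs : 1 ≤ (Real.sinh z.im)^2 := by
    have : 1 ≤ |Real.sinh z.im| := by
      rw [Real.abs_sinh]
      exact hz.trans (Real.self_le_sinh_iff.mpr (abs_nonneg _))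
    rw [← sq_abs]; nlinarith
  have hc2 := Real.cosh_sq z.im
  have hx := Real.sin_sq_add_cos_sq z.re
  have hcos : Complex.normSq (Complex.cos z) =
      (Real.cos z.re)^2 * (Real.cosh z.im)^2 + (Real.sin z.re)^2 * (Real.sinh z.im)^2 := by
    rw [Complex.cos_eq z, ← Complex.ofReal_cos, ← Complex.ofReal_cosh, ← Complex.ofReal_sin,
      ← Complex.ofReal_sinh, Complex.normSq_apply]
    simp only [add_re, sub_re, mul_re, ofReal_re, ofReal_im, I_re, I_im, add_im, sub_im, mul_im]
    ring
  have hsin : Complex.normSq (Complex.sin z) =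
      (Real.sin z.re)^2 * (Real.cosh z.im)^2 + (Real.cos z.re)^2 * (Real.sinh z.im)^2 := by
    rw [Complex.sin_eq z, ← Complex.ofReal_cos, ← Complex.ofReal_cosh, ← Complex.ofReal_sin,
      ← Complex.ofReal_sinh, Complex.normSq_apply]
    simp only [add_re, sub_re, mul_re, ofReal_re, ofReal_im, I_re, I_im, add_im, sub_im, mul_im]
    ring
  have h1 : (Real.sinh z.im)^2 ≤ Complex.normSq (Complex.cos z) := by
    rw [hcos, hc2]; nlinarith [sq_nonneg (Real.cos z.re)]
  have h2 : Complex.normSq (Complex.sin z) ≤ 2 * (Real.sinh z.im)^2 := by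
    rw [hsin, hc2]; nlinarith [sq_nonneg (Real.cos z.re)]
  have hne : Complex.cos z ≠ 0 := by
    intro h; rw [h] at h1; simp at h1; rw [h1] at hs; norm_num at hs
  refine ⟨hne, ?_⟩
  rw [Complex.tan, norm_div, div_le_iff₀ (norm_pos_iff.mpr hne)]
  apply le_of_sq_le_sq _ (by positivity)
  rw [mul_pow, ← Complex.normSq_eq_norm_sq, ← Complex.normSq_eq_norm_sq]
  nlinarith

lemma fe_logDeriv {w : ℂ} (hre : 0 < w.re) (him : 1 ≤ |w.im|) (hz : riemannZeta w ≠ 0) :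
    riemannZeta (1-w) ≠ 0 ∧
    logDeriv riemannZeta (1-w) + logDeriv riemannZeta w + logDeriv Complex.Gamma w
      = Complex.log (2*π) + π/2 * Complex.tan (π * w / 2) := by
  have him0 : w.im ≠ 0 := by intro h; rw [h] at him; norm_num at him
  have hw1 : w ≠ 1 := by intro h; rw [h] at him0; simp at him0
  have h2pi : (2 * (π:ℂ)) ≠ 0 := by simp
  have him2 : 1 ≤ |(π * w / 2).im| := by
    have : (π * w / 2).im = π/2 * w.im := by
      have : π * w / 2 = ((π/2 : ℝ):ℂ) * w := by push_cast; ring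
      rw [this, Complex.im_ofReal_mul]
    rw [this, abs_mul, abs_of_pos (by positivity)]
    nlinarith [Real.pi_gt_three]
  obtain ⟨hcos, -⟩ := tan_bound him2
  have hG : Complex.Gamma w ≠ 0 := Complex.Gamma_ne_zero_of_re_pos hre
  have hwn : ∀ n : ℕ, w ≠ -n := ne_neg_nat hre
  have hfe := riemannZeta_one_sub hwn hw1
  have hcp : (2 * (π:ℂ)) ^ (-w) ≠ 0 := by
    rw [Complex.cpow_def_of_ne_zero h2pi]; exact Complex.exp_ne_zero _
  constructor
  · rw [hfe]
    simp [hcp, hG, hz, hcos]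
  · have hev : (fun z => riemannZeta (1 - z)) =ᶠ[𝓝 w]
        fun z => 2 * (2 * (π:ℂ)) ^ (-z) * Complex.Gamma z * Complex.cos (π * z / 2) * riemannZeta z := by
      have ho : {z : ℂ | 0 < z.re} ∩ {z : ℂ | z ≠ 1} ∈ 𝓝 w :=
        ((isOpen_lt continuous_const Complex.continuous_re).inter isOpen_ne).mem_nhds ⟨hre, hw1⟩
      filter_upwards [ho] with z hz
      exact riemannZeta_one_sub (ne_neg_nat hz.1) hz.2
    have hl : logDeriv (fun z => riemannZeta (1 - z)) w = - logDeriv riemannZeta (1-w) := by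
      have := logDeriv_comp (f := riemannZeta) (g := fun z => 1 - z) (x := w)
        (differentiableAt_riemannZeta (by intro h; rw [sub_eq_self] at h; rw [h] at him0; simp at him0))
        (by fun_prop)
      have e : (riemannZeta ∘ fun z => 1 - z) = fun z => riemannZeta (1-z) := rfl
      rw [e] at this
      rw [this, deriv_const_sub, deriv_id'']; ring
    have hd1 : DifferentiableAt ℂ (fun z => 2 * (2 * (π:ℂ)) ^ (-z)) w := by
      apply DifferentiableAt.const_mul
      exact (differentiableAt_id.neg).const_cpow (Or.inl h2pi)
    have hd2 : DifferentiableAt ℂ Complex.Gamma w := Complex.differentiableAt_Gamma w hwn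
    have hd3 : DifferentiableAt ℂ (fun z : ℂ => Complex.cos (π * z / 2)) w := by fun_prop
    have hd4 := differentiableAt_riemannZeta hw1
    have hr : logDeriv (fun z => riemannZeta (1 - z)) w =
        logDeriv (fun z => 2 * (2 * (π:ℂ)) ^ (-z) * Complex.Gamma z * Complex.cos (π * z / 2) * riemannZeta z) w := by
      rw [logDeriv_apply, logDeriv_apply, hev.deriv_eq, hev.eq_of_nhds]
    rw [logDeriv_mul (f := fun z => 2 * (2 * (π:ℂ)) ^ (-z) * Complex.Gamma z * Complex.cos (π * z / 2))
        (g := riemannZeta) w (by simp [hcp, hG, hcos]) hz ((hd1.mul hd2).mul hd3) hd4,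
      logDeriv_mul (f := fun z => 2 * (2 * (π:ℂ)) ^ (-z) * Complex.Gamma z)
        (g := fun z => Complex.cos (π * z / 2)) w (by simp [hcp, hG]) hcos (hd1.mul hd2) hd3,
      logDeriv_mul (f := fun z => 2 * (2 * (π:ℂ)) ^ (-z))
        (g := Complex.Gamma) w (by simp [hcp]) hG hd1 hd2] at hr
    have l1 : logDeriv (fun z => 2 * (2 * (π:ℂ)) ^ (-z)) w = - Complex.log (2*π) := by
      have hd := ((hasDerivAt_id w).neg.const_cpow (c := 2*(π:ℂ)) (Or.inl h2pi)).const_mul (2:ℂ)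
      rw [logDeriv_apply]
      have := hd.deriv
      simp only [id, Pi.neg_apply] at this
      rw [show deriv (fun z => 2 * (2 * (π:ℂ)) ^ (-z)) w = _ from this]
      field_simp
    have l3 : logDeriv (fun z : ℂ => Complex.cos (π * z / 2)) w = - (π/2 * Complex.tan (π * w/2)) := by
      have hd : HasDerivAt (fun z : ℂ => (π:ℂ) * z / 2) (π/2) w := by
        simpa using ((hasDerivAt_id w).const_mul (π:ℂ)).div_const 2
      rw [logDeriv_apply, hd.ccos.deriv, Complex.tan]
      ring
    rw [hl, l1, l3] at hr
    linear_combination -hr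

noncomputable def feC : ℝ := ‖Complex.log (2*π)‖ + π + dgC

lemma fe_bound {w : ℂ} (hre : 1/2 ≤ w.re) (him : 1 ≤ |w.im|) (hz : riemannZeta w ≠ 0) :
    riemannZeta (1-w) ≠ 0 ∧
    ‖logDeriv riemannZeta (1-w) + logDeriv riemannZeta w + Complex.log w‖ ≤ feC := by
  obtain ⟨h1, h2⟩ := fe_logDeriv (by linarith) him hz
  refine ⟨h1, ?_⟩
  have e : logDeriv riemannZeta (1-w) + logDeriv riemannZeta w + Complex.log w
    = Complex.log (2*π) + π/2 * Complex.tan (π * w / 2)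
      - (logDeriv Complex.Gamma w - Complex.log w) := by
    linear_combination h2
  have him2 : 1 ≤ |(π * w / 2).im| := by
    have : (π * w / 2).im = π/2 * w.im := by
      have : π * w / 2 = ((π/2 : ℝ):ℂ) * w := by push_cast; ring
      rw [this, Complex.im_ofReal_mul]
    rw [this, abs_mul, abs_of_pos (by positivity)]
    nlinarith [Real.pi_gt_three]
  rw [e]
  have hp : ‖(π:ℂ)/2‖ = π/2 := by
    rw [norm_div, Complex.norm_real, Real.norm_of_nonneg Real.pi_pos.le]; simp
  calc _ ≤ ‖Complex.log (2*π)‖ + ‖(π:ℂ)/2 * Complex.tan (π * w / 2)‖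
        + ‖logDeriv Complex.Gamma w - Complex.log w‖ :=
        (norm_sub_le _ _).trans (add_le_add_left (norm_add_le _ _) _)
    _ ≤ _ := by
      unfold feC
      have := (tan_bound him2).2
      have := digamma_bound hre
      rw [norm_mul, hp]
      have : π/2 * ‖Complex.tan (π * w / 2)‖ ≤ π / 2 * 2 := by gcongr
      linarith

lemma zeta_conj_logDeriv (s : ℂ) (hs : s ≠ 1) :
    logDeriv riemannZeta ((starRingEnd ℂ) s) = (starRingEnd ℂ) (logDeriv riemannZeta s) := by
  have h := (differentiableAt_riemannZeta hs).hasDerivAt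
  have h2 := h.conj_conj
  have e : (⇑(starRingEnd ℂ) ∘ riemannZeta ∘ ⇑(starRingEnd ℂ)) = riemannZeta := by
    funext z
    simp [riemannZeta_conj]
  rw [e] at h2
  rw [logDeriv_apply, logDeriv_apply, h2.deriv, riemannZeta_conj, map_div₀]

lemma logDeriv_two : ∃ C : ℝ, ∀ s : ℂ, s.re = 2 → ‖logDeriv riemannZeta s‖ ≤ C := by
  have hsum := ArithmeticFunction.LSeriesSummable_vonMangoldt (s := 2) (by simp)
  refine ⟨∑' n, ‖LSeries.term (fun n => (ArithmeticFunction.vonMangoldt n : ℂ)) 2 n‖, fun s hs => ?_⟩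
  have h := ArithmeticFunction.LSeries_vonMangoldt_eq_deriv_riemannZeta_div (s := s) (by linarith)
  have hh : logDeriv riemannZeta s = - LSeries (fun n => (ArithmeticFunction.vonMangoldt n : ℂ)) s := by
    rw [h, logDeriv_apply]; ring
  rw [hh, norm_neg]
  have e : ∀ n, ‖LSeries.term (fun n => (ArithmeticFunction.vonMangoldt n : ℂ)) s n‖ =
      ‖LSeries.term (fun n => (ArithmeticFunction.vonMangoldt n : ℂ)) 2 n‖ := by
    intro n
    simp only [LSeries.norm_term_eq, hs]
    simp
  unfold LSeries
  have h3 := norm_tsum_le_tsum_norm (f := LSeries.term (fun n => (ArithmeticFunction.vonMangoldt n : ℂ)) s)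
    (by simp only [e]; exact hsum.norm)
  simpa only [e] using h3

lemma zeta_two_lower {s : ℂ} (hs : s.re = 2) : 1/4 ≤ ‖riemannZeta s‖ := by
  have hz := zeta_eq_tsum_one_div_nat_add_one_cpow (s := s) (by linarith)
  have hn : ∀ n : ℕ, ‖1 / ((n:ℂ)+1)^s‖ = 1/((n:ℝ)+1)^2 := by
    intro n
    have : ((n:ℂ)+1) = ((n+1 : ℕ):ℂ) := by push_cast; rfl
    rw [norm_div, this, Complex.norm_natCast_cpow_of_pos (by positivity), hs]
    simp
  have hs1 : Summable fun n : ℕ => 1/((n:ℝ)+1)^2 := by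
    have h := (summable_nat_add_iff 1).mpr ((Real.summable_one_div_nat_pow (p := 2)).mpr (by norm_num))
    simpa using h
  have hs2 : Summable fun n : ℕ => 1 / ((n:ℂ)+1)^s := by
    apply Summable.of_norm; simp only [hn]; exact hs1
  have hv : ∑' n : ℕ, 1/((n:ℝ)+1)^2 = π^2/6 := by
    have h := hasSum_zeta_two
    have h2 := h.summable.tsum_eq_zero_add
    rw [h.tsum_eq] at h2
    simp at h2
    rw [h2]; simp
  rw [hs2.tsum_eq_zero_add] at hz
  rw [hs1.tsum_eq_zero_add] at hv
  have h3 : ‖∑' n : ℕ, 1 / (((n+1:ℕ):ℂ)+1)^s‖ ≤ ∑' n : ℕ, 1/(((n+1:ℕ):ℝ)+1)^2 := by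
    have := norm_tsum_le_tsum_norm (f := fun n : ℕ => 1 / (((n+1:ℕ):ℂ)+1)^s)
      (by simp only [hn]; exact (summable_nat_add_iff 1).mpr hs1)
    simpa only [hn] using this
  simp only [Nat.cast_zero, zero_add, Complex.one_cpow, div_one] at hz
  norm_num at hv
  have h4 : ‖(1:ℂ)‖ - ‖∑' n : ℕ, 1 / (((n+1:ℕ):ℂ)+1)^s‖ ≤ ‖riemannZeta s‖ := by
    rw [hz]; 
    exact norm_sub_le_norm_add _ _
  have hp : π^2/6 ≤ 1.7 := by nlinarith [Real.pi_lt_d2, Real.pi_pos]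
  rw [norm_one] at h4
  push_cast at *
  norm_num at h3 hp h4
  linarith
end Rad

namespace Rad
open Topology

lemma zeta_anOn : AnalyticOnNhd ℂ riemannZeta {1}ᶜ := by
  apply DifferentiableOn.analyticOnNhd _ isOpen_compl_singleton
  intro z hz
  exact (differentiableAt_riemannZeta hz).differentiableWithinAt

lemma zeta_order_ne_top {a : ℂ} (ha : a ≠ 1) : analyticOrderAt riemannZeta a ≠ ⊤ := by
  have hpc : IsPreconnected ({1}ᶜ : Set ℂ) :=
    (isConnected_compl_singleton_of_one_lt_rank (by simp) 1).isPreconnected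
  refine zeta_anOn.analyticOrderAt_ne_top_of_isPreconnected hpc (x := 2) (by simp) ha ?_
  have h2 : riemannZeta 2 ≠ 0 := riemannZeta_ne_zero_of_one_le_re (by simp)
  rw [(zeta_anOn 2 (by simp)).analyticOrderAt_eq_zero.mpr h2]
  simp

lemma zeta_local {a : ℂ} (ha : a ≠ 1) : ∃ h : ℂ → ℂ, AnalyticAt ℂ h a ∧ h a ≠ 0 ∧
    ∀ᶠ z in 𝓝 a, riemannZeta z = (z - a)^(zetaZeroMult a) * h z := by
  have han := zeta_anOn a ha
  have h1 : analyticOrderAt riemannZeta a = (zetaZeroMult a : ℕ) := by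
    unfold zetaZeroMult
    rw [dif_pos han, ENat.natCast_toNat (zeta_order_ne_top ha)]
  exact han.analyticOrderAt_eq_natCast.mp h1

lemma factor (Z : Finset ℂ) : (1 ∉ Z) → ∃ g : ℂ → ℂ, AnalyticOnNhd ℂ g {1}ᶜ ∧
    (∀ z, z ≠ 1 → riemannZeta z = (∏ ρ ∈ Z, (z - ρ)^(zetaZeroMult ρ)) * g z) ∧ ∀ ρ ∈ Z, g ρ ≠ 0 := by
  classical
  induction Z using Finset.induction_on with
  | empty => exact fun _ => ⟨riemannZeta, zeta_anOn, by simp, by simp⟩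
  | insert a Z haZ ih =>
    intro h1
    rw [Finset.mem_insert, not_or] at h1
    obtain ⟨g, hg, hfac, hne⟩ := ih h1.2
    have ha : a ≠ 1 := fun h => h1.1 h.symm
    obtain ⟨h, hh, hha, hev⟩ := zeta_local ha
    set m := zetaZeroMult a
    set P : ℂ → ℂ := fun z => ∏ ρ ∈ Z, (z - ρ)^(zetaZeroMult ρ) with hP
    have hPan : ∀ z, AnalyticAt ℂ P z := by
      intro z
      apply Differentiable.analyticAt
      rw [hP]; fun_prop
    have hPa : P a ≠ 0 := by
      rw [hP]
      simp only [ne_eq, Finset.prod_eq_zero_iff, not_exists, not_and]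
      intro ρ hρ h0
      have h3 : a - ρ = 0 := by
        by_contra h4; exact pow_ne_zero _ h4 h0
      rw [sub_eq_zero] at h3
      exact haZ (h3 ▸ hρ)
    have hPev : ∀ᶠ z in 𝓝 a, P z ≠ 0 := (hPan a).continuousAt.eventually_ne hPa
    refine ⟨Function.update (fun z => g z / (z - a)^m) a (h a / P a), ?_, ?_, ?_⟩
    · intro z hz
      by_cases hza : z = a
      · rw [hza]
        have h3 : AnalyticAt ℂ (fun z => h z / P z) a := hh.div (hPan a) hPa
        refine h3.congr ?_
        have h1' : ∀ᶠ z in 𝓝 a, z ≠ 1 := isOpen_ne.mem_nhds ha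
        filter_upwards [hev, hPev, h1'] with w hw hPw hw1
        by_cases hwa : w = a
        · rw [hwa]; simp
        · rw [Function.update_of_ne hwa]
          have e := hfac w hw1
          rw [hw] at e
          have hwm : (w - a)^m ≠ 0 := pow_ne_zero _ (sub_ne_zero.mpr hwa)
          rw [div_eq_div_iff hPw hwm]
          rw [mul_comm, e]; ring
      · have h3 : AnalyticAt ℂ (fun z => g z / (z-a)^m) z :=
          (hg z hz).div ((analyticAt_id.sub analyticAt_const).pow m)
            (pow_ne_zero _ (sub_ne_zero.mpr hza))
        refine h3.congr ?_
        filter_upwards [isOpen_ne.mem_nhds hza] with w hw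
        rw [Function.update_of_ne hw]
    · intro z hz
      rw [Finset.prod_insert haZ]
      by_cases hza : z = a
      · rw [hza, Function.update_self, hev.self_of_nhds]
        have : ∏ ρ ∈ Z, (a - ρ)^(zetaZeroMult ρ) = P a := rfl
        rw [this]
        field_simp
        rfl
      · rw [Function.update_of_ne hza, hfac z hz]
        have hwm : (z - a)^m ≠ 0 := pow_ne_zero _ (sub_ne_zero.mpr hza)
        have : (z - a)^(zetaZeroMult a) = (z-a)^m := rfl
        rw [this]
        field_simp
    · intro ρ hρ
      rw [Finset.mem_insert] at hρ
      by_cases hra : ρ = a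
      · rw [hra, Function.update_self]
        exact div_ne_zero hha hPa
      · rw [Function.update_of_ne hra]
        exact div_ne_zero (hne ρ (hρ.resolve_left hra)) (pow_ne_zero _ (sub_ne_zero.mpr hra))

/-- Borel–Carathéodory bound for the logarithmic derivative. -/
lemma bc_logDeriv {G : ℂ → ℂ} {A : ℝ} (hA : 1 < A)
    (hd : DifferentiableOn ℂ G (Metric.ball 0 1.7)) (hne : ∀ z ∈ Metric.ball (0:ℂ) 1.7, G z ≠ 0)
    (hb : ∀ z ∈ Metric.ball (0:ℂ) 1.7, ‖G z‖ ≤ A * ‖G 0‖) {z : ℂ} (hz : ‖z‖ ≤ 1.6) :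
    ‖logDeriv G z‖ ≤ 1320 * Real.log A := by
  have hLpos : 0 < Real.log A := Real.log_pos hA
  have hHd : DifferentiableOn ℂ (logDeriv G) (Metric.ball 0 1.7) := by
    have := (hd.deriv Metric.isOpen_ball).div hd hne
    exact this
  obtain ⟨F, hF0, hF⟩ := (DifferentiableOn.isExactOn_ball hHd).with_val_at 0 0
  have h0 : (0:ℂ) ∈ Metric.ball (0:ℂ) 1.7 := by simp; norm_num
  have hFd : DifferentiableOn ℂ F (Metric.ball 0 1.7) := fun w hw =>
    (hF w hw).differentiableAt.differentiableWithinAt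
  have hconst : ∀ w ∈ Metric.ball (0:ℂ) 1.7, G w * Complex.exp (-F w) = G 0 := by
    intro w hw
    have hder : ∀ w ∈ Metric.ball (0:ℂ) 1.7,
        HasDerivAt (fun w => G w * Complex.exp (-F w)) 0 w := by
      intro w hw
      have h1 := (hd.differentiableAt (Metric.isOpen_ball.mem_nhds hw)).hasDerivAt
      have h2 := (hF w hw).neg.cexp
      have h3 := h1.mul h2
      refine h3.congr_deriv ?_
      rw [logDeriv_apply]
      have := hne w hw
      simp only [Pi.neg_apply]
      field_simp
      ring
    have := (convex_ball (0:ℂ) 1.7).is_const_of_fderivWithin_eq_zero (𝕜 := ℂ)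
      (f := fun w => G w * Complex.exp (-F w))
      (fun w hw => (hder w hw).differentiableAt.differentiableWithinAt)
      (fun w hw => by
        rw [fderivWithin_of_isOpen Metric.isOpen_ball hw]
        have := (hder w hw).hasFDerivAt.fderiv
        rw [this]; ext; simp) hw h0
    rw [this, hF0]; simp
  have hre : ∀ w ∈ Metric.ball (0:ℂ) 1.7, (F w).re ≤ Real.log A := by
    intro w hw
    have h1 := hconst w hw
    have hG0 : 0 < ‖G 0‖ := norm_pos_iff.mpr (hne 0 h0)
    have h2 : ‖G w‖ = ‖G 0‖ * Real.exp (F w).re := by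
      rw [← h1, norm_mul, Complex.norm_exp]
      simp only [Complex.neg_re]
      rw [mul_assoc, ← Real.exp_add]; simp
    have h3 := hb w hw
    rw [h2] at h3
    rw [Real.le_log_iff_exp_le (by linarith)]
    nlinarith
  have hFb : ∀ w : ℂ, ‖w‖ ≤ 1.65 → ‖F w‖ ≤ 66 * Real.log A := by
    intro w hw
    have hw' : w ∈ Metric.ball (0:ℂ) 1.7 := by simp; linarith
    have := Complex.borelCaratheodory_zero hLpos hFd hre (by norm_num) hw' hF0
    refine this.trans ?_
    rw [div_le_iff₀ (by linarith)]
    nlinarith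
  have hz' : z ∈ Metric.ball (0:ℂ) 1.7 := by simp; linarith
  rw [← (hF z hz').deriv]
  have hsub : Metric.closedBall z 0.05 ⊆ Metric.ball (0:ℂ) 1.7 := by
    intro w hw
    simp only [Metric.mem_closedBall, Metric.mem_ball, dist_zero_right] at *
    rw [dist_eq_norm] at hw
    have := norm_le_norm_add_norm_sub' w z
    linarith
  have h5 := Complex.norm_deriv_le_of_forall_mem_sphere_norm_le (c := z) (R := 0.05) (f := F)
    (C := 66 * Real.log A) (by norm_num)
    (DifferentiableOn.diffContOnCl (by
      rw [closure_ball _ (by norm_num)]; exact hFd.mono hsub))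
    (fun w hw => hFb w (by
      simp only [Metric.mem_sphere] at hw
      rw [dist_eq_norm] at hw
      have := norm_le_norm_add_norm_sub' w z
      linarith))
  refine h5.trans (le_of_eq ?_)
  ring
end Rad

namespace Rad
open Topology

noncomputable def cT (T : ℝ) : ℂ := ⟨2, T + 1/2⟩

lemma near_cT {T : ℝ} (hT : 3 ≤ T) {u : ℂ} (hu : ‖u‖ ≤ 1.95) :
    1/20 ≤ (cT T + u).re ∧ 1 ≤ (cT T + u).im ∧ cT T + u ≠ 1 ∧ ‖cT T + u‖ ≤ T + 5 := by
  have h1 := (Complex.abs_re_le_norm u).trans hu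
  have h2 := (Complex.abs_im_le_norm u).trans hu
  rw [abs_le] at h1 h2
  have a : 1/20 ≤ (cT T + u).re := by simp [cT]; linarith
  have b : 1 ≤ (cT T + u).im := by simp [cT]; linarith
  refine ⟨a, b, ?_, ?_⟩
  · intro h; rw [h] at b; norm_num at b
  · have : ‖cT T‖ ≤ |(cT T).re| + |(cT T).im| := Complex.norm_le_abs_re_add_abs_im _
    simp only [cT] at this
    rw [abs_of_pos (by norm_num), abs_of_pos (by linarith)] at this
    have := norm_add_le (cT T) u
    simp only [cT] at *
    linarith

lemma zeros_compact_finite {K : Set ℂ} (hK : IsCompact K) :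
    (K ∩ {z | riemannZeta z = 0}).Finite := by
  exact hK.inter_riemannZetaZeros_finite

lemma landau {T : ℝ} (hT : 3 ≤ T) : ∃ Z : Finset ℂ,
    (∀ z, z ∈ Z ↔ ‖z - cT T‖ ≤ 1.7 ∧ riemannZeta z = 0) ∧
    (∑ ρ ∈ Z, (zetaZeroMult ρ : ℝ)) ≤ 8 * Real.log (84 * (T + 5)) ∧
    ∀ z, ‖z - cT T‖ ≤ 1.6 → riemannZeta z ≠ 0 →
      ‖logDeriv riemannZeta z - ∑ ρ ∈ Z, (zetaZeroMult ρ : ℂ) / (z - ρ)‖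
        ≤ 1336 * Real.log (84 * (T+5)) := by
  classical
  set c := cT T with hc
  set A := 84 * (T + 5) with hA
  have hA1 : 1 < A := by rw [hA]; linarith
  have hfin := zeros_compact_finite (isCompact_closedBall c 1.7)
  set Z := hfin.toFinset with hZ
  have hmem : ∀ z, z ∈ Z ↔ ‖z - c‖ ≤ 1.7 ∧ riemannZeta z = 0 := by
    intro z; rw [hZ, Set.Finite.mem_toFinset]
    simp [dist_eq_norm]
  have h1Z : 1 ∉ Z := by
    intro h
    have := (near_cT hT (u := 1 - c) (by linarith [((hmem 1).mp h).1])).2.2.1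
    rw [← hc] at this; simp at this
  obtain ⟨g, hg, hfac, hgne⟩ := factor Z h1Z
  set n := ∑ ρ ∈ Z, zetaZeroMult ρ with hn
  -- nonvanishing of g
  have hgz : ∀ z, z ≠ 1 → (riemannZeta z = 0 → z ∈ Z) → g z ≠ 0 := by
    intro z hz h h0
    by_cases hzz : riemannZeta z = 0
    · exact hgne z (h hzz) h0
    · apply hzz; rw [hfac z hz, h0, mul_zero]
  set B : ℂ → ℂ → ℂ := fun ρ u => (1.95^2 - (starRingEnd ℂ) (ρ - c) * u) / 1.95 with hB
  set G : ℂ → ℂ := fun u => (∏ ρ ∈ Z, (B ρ u)^(zetaZeroMult ρ)) * g (c + u) with hG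
  have hgd : ∀ u : ℂ, ‖u‖ ≤ 1.95 → DifferentiableAt ℂ (fun u => g (c+u)) u := by
    intro u hu
    have h := (hg (c+u) (near_cT hT hu).2.2.1).differentiableAt
    exact DifferentiableAt.comp (f := fun u => c + u) u h (by fun_prop)
  have hPd : Differentiable ℂ (fun u => ∏ ρ ∈ Z, (B ρ u)^(zetaZeroMult ρ)) := by
    simp only [hB]; fun_prop
  have hGd : ∀ u : ℂ, ‖u‖ ≤ 1.95 → DifferentiableAt ℂ G u := fun u hu =>
    (hPd u).mul (hgd u hu)
  have hBs : ∀ ρ u : ℂ, ‖u‖ = 1.95 → ‖B ρ u‖ = ‖c + u - ρ‖ := by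
    intro ρ u hu
    have e : (1.95:ℂ)^2 = (starRingEnd ℂ) u * u := by
      rw [mul_comm, Complex.mul_conj, Complex.normSq_eq_norm_sq, hu]; norm_num
    have : B ρ u = (starRingEnd ℂ) (c + u - ρ) * u / 1.95 := by
      simp only [hB]; rw [e]; simp only [map_sub, map_add]; ring
    rw [this, norm_div, norm_mul, hu, RCLike.norm_conj]
    norm_num
  have hGs : ∀ u : ℂ, ‖u‖ = 1.95 → ‖G u‖ ≤ 21 * (T+5) := by
    intro u hu
    obtain ⟨a1, a2, a3, a4⟩ := near_cT hT hu.le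
    have : ‖G u‖ = ‖riemannZeta (c+u)‖ := by
      rw [hfac _ a3]
      rw [← hc]
      simp only [hG, norm_mul, norm_prod, norm_pow, hBs _ u hu]
    rw [this]
    refine (zeta_growth a1 a2).trans ?_
    rw [← hc] at a4
    linarith
  have hGb : ∀ u : ℂ, ‖u‖ ≤ 1.95 → ‖G u‖ ≤ 21 * (T+5) := by
    intro u hu
    refine Complex.norm_le_of_forall_mem_frontier_norm_le (U := Metric.ball 0 1.95)
      Metric.isBounded_ball ?_ ?_ (z := u) ?_
    · apply DifferentiableOn.diffContOnCl
      rw [closure_ball _ (by norm_num)]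
      intro w hw
      exact (hGd w (by simpa using hw)).differentiableWithinAt
    · intro w hw
      rw [frontier_ball _ (by norm_num)] at hw
      exact hGs w (by simpa using hw)
    · rw [closure_ball _ (by norm_num)]; simpa using hu
  have hc1 := near_cT hT (u := 0) (by simp; norm_num)
  rw [← hc, add_zero] at hc1
  have hzc : 1/4 ≤ ‖riemannZeta c‖ := zeta_two_lower (by simp [hc, cT])
  have hG0 : ‖G 0‖ = 1.95^n * ‖g c‖ := by
    simp only [hG, hB, hn, mul_zero, sub_zero, add_zero, norm_mul, norm_prod, norm_pow]
    rw [← Finset.prod_pow_eq_pow_sum]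
    norm_num
  have hzc2 : ‖riemannZeta c‖ ≤ 1.7^n * ‖g c‖ := by
    rw [hfac c hc1.2.2.1, norm_mul, norm_prod, hn, ← Finset.prod_pow_eq_pow_sum]
    gcongr with ρ hρ
    rw [norm_pow, norm_sub_rev]
    gcongr
    exact ((hmem ρ).mp hρ).1
  have hnbound : (39/34:ℝ)^n ≤ A := by
    have h1 : ‖G 0‖ ≤ 21 * (T+5) := hGb 0 (by simp; norm_num)
    have h2 : (39/34:ℝ)^n * ‖riemannZeta c‖ ≤ ‖G 0‖ := by
      rw [hG0]
      calc (39/34:ℝ)^n * ‖riemannZeta c‖ ≤ (39/34:ℝ)^n * (1.7^n * ‖g c‖) := by gcongr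
        _ = _ := by rw [← mul_assoc, ← mul_pow]; norm_num
    have h3 : (39/34:ℝ)^n * (1/4) ≤ (39/34:ℝ)^n * ‖riemannZeta c‖ := by gcongr
    rw [hA]; linarith
  have hL : 0 < Real.log A := Real.log_pos hA1
  have hnlog : (n:ℝ) ≤ 8 * Real.log A := by
    have h1 := Real.log_le_log (by positivity) hnbound
    rw [Real.log_pow] at h1
    have h2 : (1:ℝ) - (39/34)⁻¹ ≤ Real.log (39/34) := Real.one_sub_inv_le_log_of_pos (by norm_num)
    have h3 : (1:ℝ)/8 ≤ Real.log (39/34) := by norm_num at h2 ⊢; linarith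
    have : (n:ℝ) * (1/8) ≤ n * Real.log (39/34) := by gcongr
    linarith
  refine ⟨Z, hmem, ?_, ?_⟩
  · have : (∑ ρ ∈ Z, (zetaZeroMult ρ : ℝ)) = n := by rw [hn]; push_cast; rfl
    rw [this]; exact hnlog
  intro z hz hzz
  set u := z - c with hu
  have hzu : z = c + u := by rw [hu]; ring
  have hcw : ∀ ρ ∈ Z, ∀ w : ℂ, ‖w‖ ≤ 1.7 → ‖(starRingEnd ℂ) (ρ - c) * w‖ ≤ 1.7 * ‖w‖ := by
    intro ρ hρ w hw
    rw [norm_mul, RCLike.norm_conj]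
    have := ((hmem ρ).mp hρ).1
    gcongr
  have hDlow : ∀ ρ ∈ Z, ∀ w : ℂ, ‖w‖ ≤ 1.7 →
      3.8025 - 1.7 * ‖w‖ ≤ ‖1.95^2 - (starRingEnd ℂ) (ρ - c) * w‖ := by
    intro ρ hρ w hw
    have h1 := norm_sub_norm_le ((1.95:ℂ)^2) ((starRingEnd ℂ) (ρ - c) * w)
    have h2 := hcw ρ hρ w hw
    have h3 : ‖(1.95:ℂ)^2‖ = 3.8025 := by norm_num
    rw [h3] at h1
    linarith
  have hBn0 : ∀ ρ ∈ Z, ∀ w : ℂ, ‖w‖ ≤ 1.7 → B ρ w ≠ 0 := by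
    intro ρ hρ w hw
    simp only [hB]
    apply div_ne_zero _ (by norm_num)
    rw [← norm_pos_iff]
    have := hDlow ρ hρ w hw
    linarith
  have hgn0 : ∀ w : ℂ, ‖w‖ ≤ 1.7 → g (c+w) ≠ 0 := by
    intro w hw
    apply hgz _ (near_cT hT (by linarith)).2.2.1
    intro h
    rw [hmem]; exact ⟨by rw [← hc]; simpa using hw, h⟩
  have hbc := bc_logDeriv (G := G) (A := A) hA1
    (fun w hw => (hGd w (by simp at hw; linarith)).differentiableWithinAt)
    (by
      intro w hw
      have hw' : ‖w‖ ≤ 1.7 := by simp at hw; linarith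
      simp only [hG]
      apply mul_ne_zero _ (hgn0 w hw')
      rw [Finset.prod_ne_zero_iff]
      intro ρ hρ
      exact pow_ne_zero _ (hBn0 ρ hρ w hw'))
    (by
      intro w hw
      have hw' : ‖w‖ ≤ 1.95 := by simp at hw; linarith
      have h1 := hGb w hw'
      have h2 : 1/4 ≤ ‖G 0‖ := by
        rw [hG0]
        refine (hzc.trans hzc2).trans ?_
        gcongr
        norm_num
      have : A * (1/4) ≤ A * ‖G 0‖ := by gcongr
      rw [hA] at this ⊢
      linarith) (z := u) hz
  have hu17 : ‖u‖ ≤ 1.7 := by linarith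
  have hu195 : ‖u‖ ≤ 1.95 := by linarith
  -- log derivative of G
  have hlG : logDeriv G u = ∑ ρ ∈ Z, (zetaZeroMult ρ : ℂ) *
      (-(starRingEnd ℂ) (ρ - c) / (1.95^2 - (starRingEnd ℂ) (ρ - c) * u)) + logDeriv g z := by
    rw [hG, logDeriv_mul (f := fun u => ∏ ρ ∈ Z, (B ρ u)^(zetaZeroMult ρ)) (g := fun u => g (c+u)) u
      (by
        rw [Finset.prod_ne_zero_iff]
        intro ρ hρ
        exact pow_ne_zero _ (hBn0 ρ hρ u hu17)) (hgn0 u hu17) (hPd u) (hgd u hu195)]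
    congr 1
    · have := logDeriv_prod (ι := ℂ) (s := Z) (f := fun ρ u => (B ρ u)^(zetaZeroMult ρ)) (x := u)
        (fun ρ hρ => pow_ne_zero _ (hBn0 ρ hρ u hu17)) (fun ρ hρ => by simp only [hB]; fun_prop)
      rw [this]
      apply Finset.sum_congr rfl
      intro ρ hρ
      rw [logDeriv_fun_pow (f := B ρ) (by simp only [hB]; fun_prop)]
      congr 1
      have hd : HasDerivAt (B ρ) (-(starRingEnd ℂ) (ρ - c) / 1.95) u := by
        have := (((hasDerivAt_id u).const_mul ((starRingEnd ℂ) (ρ - c))).const_sub (1.95^2)).div_const 1.95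
        simpa [hB] using this
      rw [logDeriv_apply, hd.deriv]
      simp only [hB]
      rw [div_div_div_cancel_right₀ (by norm_num)]
    · have := logDeriv_comp (f := g) (g := fun u => c + u) (x := u)
        (hg _ (near_cT hT hu195).2.2.1).differentiableAt (by fun_prop)
      rw [← hzu] at this
      have e : (g ∘ fun u => c + u) = fun u => g (c+u) := rfl
      rw [e] at this
      rw [this]; simp
  have hz1 : z ≠ 1 := by rw [hzu]; exact (near_cT hT hu195).2.2.1
  have hzρ : ∀ ρ ∈ Z, z - ρ ≠ 0 := by
    intro ρ hρ h
    rw [sub_eq_zero] at h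
    rw [h] at hzz
    exact hzz ((hmem ρ).mp hρ).2
  have hlz : logDeriv riemannZeta z = ∑ ρ ∈ Z, (zetaZeroMult ρ : ℂ) / (z - ρ) + logDeriv g z := by
    have hev : riemannZeta =ᶠ[𝓝 z] fun z => (∏ ρ ∈ Z, (z - ρ)^(zetaZeroMult ρ)) * g z := by
      filter_upwards [isOpen_ne.mem_nhds hz1] with w hw using hfac w hw
    have e1 : logDeriv riemannZeta z = logDeriv (fun z => (∏ ρ ∈ Z, (z - ρ)^(zetaZeroMult ρ)) * g z) z := by
      rw [logDeriv_apply, logDeriv_apply, hev.deriv_eq, hev.eq_of_nhds]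
    rw [e1, logDeriv_mul (f := fun z => ∏ ρ ∈ Z, (z - ρ)^(zetaZeroMult ρ)) (g := g) z
      (by
        rw [Finset.prod_ne_zero_iff]
        intro ρ hρ
        exact pow_ne_zero _ (hzρ ρ hρ)) (by rw [hzu]; exact hgn0 u hu17) (by fun_prop)
      (hg z hz1).differentiableAt]
    congr 1
    have := logDeriv_prod (ι := ℂ) (s := Z) (f := fun ρ z => (z - ρ)^(zetaZeroMult ρ)) (x := z)
        (fun ρ hρ => pow_ne_zero _ (hzρ ρ hρ)) (fun ρ hρ => by fun_prop)
    rw [this]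
    apply Finset.sum_congr rfl
    intro ρ hρ
    rw [logDeriv_fun_pow (f := fun z => z - ρ) (by fun_prop)]
    rw [logDeriv_apply]
    simp [div_eq_mul_inv]
  have e : logDeriv riemannZeta z - ∑ ρ ∈ Z, (zetaZeroMult ρ : ℂ) / (z - ρ)
      = logDeriv G u - ∑ ρ ∈ Z, (zetaZeroMult ρ : ℂ) *
      (-(starRingEnd ℂ) (ρ - c) / (1.95^2 - (starRingEnd ℂ) (ρ - c) * u)) := by
    rw [hlz, hlG]; ring
  rw [e]
  refine (norm_sub_le _ _).trans ?_
  have h6 : ‖∑ ρ ∈ Z, (zetaZeroMult ρ : ℂ) *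
      (-(starRingEnd ℂ) (ρ - c) / (1.95^2 - (starRingEnd ℂ) (ρ - c) * u))‖ ≤ n * 2 := by
    refine (norm_sum_le _ _).trans ?_
    rw [hn]; push_cast
    rw [Finset.sum_mul]
    apply Finset.sum_le_sum
    intro ρ hρ
    rw [norm_mul, norm_div, norm_neg, RCLike.norm_conj, RCLike.norm_natCast]
    gcongr
    have h1 := hDlow ρ hρ u hu17
    have h2 := ((hmem ρ).mp hρ).1
    rw [div_le_iff₀ (by linarith)]
    linarith
  linarith
end Rad

namespace Rad
open Topology

lemma mult_pos {ρ : ℂ} (h1 : ρ ≠ 1) (h : riemannZeta ρ = 0) : 1 ≤ zetaZeroMult ρ := by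
  obtain ⟨g, hg, hg0, hev⟩ := zeta_local h1
  by_contra hlt
  have h0 : zetaZeroMult ρ = 0 := by omega
  have := hev.self_of_nhds
  rw [h0, h] at this
  simp at this
  exact hg0 this.symm

lemma L_bounds {T : ℝ} (hT : 3 ≤ T) : 1 ≤ Real.log (84 * (T+5)) ∧
    Real.log (84*(T+5))^2 ≤ 1008 * T := by
  have h1 : 1 ≤ Real.log (84 * (T+5)) := by
    rw [Real.le_log_iff_exp_le (by linarith)]
    have := Real.exp_one_lt_d9
    linarith
  refine ⟨h1, ?_⟩
  have hx : 0 < 84 * (T+5) := by linarith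
  have h2 : Real.log (84*(T+5)) = 2 * Real.log (Real.sqrt (84*(T+5))) := by
    rw [Real.log_sqrt hx.le]; ring
  have h3 : Real.log (Real.sqrt (84*(T+5))) ≤ Real.sqrt (84*(T+5)) :=
    (Real.log_le_sub_one_of_pos (Real.sqrt_pos.mpr hx)).trans (by linarith)
  have h4 := Real.sq_sqrt hx.le
  have h5 : Real.log (84*(T+5)) ≤ 2 * Real.sqrt (84*(T+5)) := by linarith
  calc Real.log (84*(T+5))^2 ≤ (2 * Real.sqrt (84*(T+5)))^2 := by gcongr
    _ ≤ _ := by rw [mul_pow, h4]; linarith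

lemma norm_sub_cT {T T' σ : ℝ} (hσ : σ ∈ Icc (1/2:ℝ) 2) (hT' : T' ∈ Icc T (T+1)) :
    ‖(⟨σ, T'⟩ : ℂ) - cT T‖ ≤ 1.6 := by
  apply le_of_sq_le_sq _ (by norm_num)
  rw [← Complex.normSq_eq_norm_sq, Complex.normSq_apply]
  simp only [cT, sub_re, sub_im]
  obtain ⟨a, b⟩ := hσ
  obtain ⟨c, d⟩ := hT'
  nlinarith

lemma local_count {T : ℝ} (hT : 3 ≤ T) (S : Finset ℂ)
    (hS : ∀ ρ ∈ S, riemannZeta ρ = 0 ∧ ρ.re = 1/2 ∧ ρ.im ∈ Icc T (T+1)) :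
    ∑ ρ ∈ S, (zetaZeroMult ρ : ℝ) ≤ 10000 * T := by
  obtain ⟨Z, hZ, hn, -⟩ := landau hT
  have hsub : S ⊆ Z := by
    intro ρ hρ
    obtain ⟨h1, h2, h3⟩ := hS ρ hρ
    rw [hZ]
    refine ⟨?_, h1⟩
    have := norm_sub_cT (σ := ρ.re) (T' := ρ.im) (T := T) (by rw [h2]; constructor <;> norm_num) h3
    refine this.trans (by norm_num)
  obtain ⟨l1, l2⟩ := L_bounds hT
  calc _ ≤ ∑ ρ ∈ Z, (zetaZeroMult ρ : ℝ) :=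
        Finset.sum_le_sum_of_subset_of_nonneg hsub (fun _ _ _ => by positivity)
    _ ≤ _ := by nlinarith

lemma pigeon {T : ℝ} (Z : Finset ℂ) : ∃ T' ∈ Icc T (T+1), ∀ ρ ∈ Z,
    1 / (2 * ((Z.card:ℝ) + 1)) ≤ |T' - ρ.im| := by
  by_contra! hcon
  set k := Z.card with hk
  have hpt : ∀ j ∈ Finset.range (k+1), T + j / ((k:ℝ)+1) ∈ Icc T (T+1) := by
    intro j hj
    rw [Finset.mem_range] at hj
    have h1 : (j:ℝ) ≤ k := by exact_mod_cast Nat.lt_succ_iff.mp hj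
    have h2 : (0:ℝ) ≤ j / ((k:ℝ)+1) := by positivity
    have h3 : (j:ℝ) / ((k:ℝ)+1) ≤ 1 := by rw [div_le_one (by positivity)]; linarith
    constructor <;> linarith
  have hex : ∀ j : ℕ, ∃ ρ : ℂ, j ∈ Finset.range (k+1) → ρ ∈ Z ∧
      |T + j / ((k:ℝ)+1) - ρ.im| < 1 / (2 * ((k:ℝ) + 1)) := by
    intro j
    by_cases hj : j ∈ Finset.range (k+1)
    · obtain ⟨ρ, h1, h2⟩ := hcon _ (hpt j hj)
      exact ⟨ρ, fun _ => ⟨h1, h2⟩⟩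
    · exact ⟨0, fun h => absurd h hj⟩
  choose f hf using hex
  obtain ⟨i, hi, j, hj, hij, he⟩ := Finset.exists_ne_map_eq_of_card_lt_of_maps_to
    (s := Finset.range (k+1)) (t := Z) (f := f) (by simp [← hk]) (fun j hj => (hf j hj).1)
  have h1 := (hf i hi).2
  have h2 := (hf j hj).2
  rw [he] at h1
  have h3 : |(i:ℝ) / ((k:ℝ)+1) - j / ((k:ℝ)+1)| < 1 / ((k:ℝ)+1) := by
    have e : (1:ℝ) / ((k:ℝ)+1) = 1 / (2 * ((k:ℝ) + 1)) + 1 / (2 * ((k:ℝ) + 1)) := by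
      field_simp; norm_num
    rw [e]
    rw [abs_lt] at *
    constructor <;> linarith [h1.1, h1.2, h2.1, h2.2]
  rw [← sub_div, abs_div, abs_of_pos (by positivity : (0:ℝ) < (k:ℝ)+1)] at h3
  rw [div_lt_div_iff_of_pos_right (by positivity)] at h3
  have h4 : |(i:ℤ) - (j:ℤ)| < 1 := by exact_mod_cast h3
  rw [Int.abs_lt_one_iff] at h4
  omega

lemma good_right {T : ℝ} (hT : 3 ≤ T) : ∃ T' ∈ Icc T (T+1), ∀ σ ∈ Icc (1/2:ℝ) 2,
    riemannZeta ⟨σ, T'⟩ ≠ 0 ∧ ‖logDeriv riemannZeta ⟨σ, T'⟩‖ ≤ 2000000 * T := by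
  obtain ⟨Z, hZ, hn, hL⟩ := landau hT
  obtain ⟨T', hT', hp⟩ := pigeon (T := T) Z
  obtain ⟨l1, l2⟩ := L_bounds hT
  refine ⟨T', hT', fun σ hσ => ?_⟩
  have hd := norm_sub_cT hσ hT'
  have hne : riemannZeta ⟨σ, T'⟩ ≠ 0 := by
    intro h
    have hmem : (⟨σ, T'⟩ : ℂ) ∈ Z := by rw [hZ]; exact ⟨hd.trans (by norm_num), h⟩
    have := hp _ hmem
    simp only [sub_self, abs_zero] at this
    have h2 : (0:ℝ) < 1 / (2 * ((Z.card:ℝ)+1)) := by positivity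
    linarith
  refine ⟨hne, ?_⟩
  have h1 := hL _ hd hne
  set L := Real.log (84*(T+5))
  set n := ∑ ρ ∈ Z, (zetaZeroMult ρ : ℝ) with hnd
  have hcard : (Z.card : ℝ) ≤ n := by
    rw [hnd, Finset.cast_card]
    apply Finset.sum_le_sum
    intro ρ hρ
    have := (hZ ρ).mp hρ
    have h2 : ρ ≠ 1 := by
      have := (near_cT hT (u := ρ - cT T) (by linarith [this.1])).2.2.1
      simpa using this
    exact_mod_cast mult_pos h2 this.2
  have h2 : ‖∑ ρ ∈ Z, (zetaZeroMult ρ : ℂ) / ((⟨σ, T'⟩ : ℂ) - ρ)‖ ≤ n * (2 * ((Z.card:ℝ) + 1)) := by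
    refine (norm_sum_le _ _).trans ?_
    rw [hnd, Finset.sum_mul]
    apply Finset.sum_le_sum
    intro ρ hρ
    rw [norm_div, RCLike.norm_natCast, div_eq_mul_inv]
    gcongr
    have h3 := hp ρ hρ
    have h4 := Complex.abs_im_le_norm ((⟨σ, T'⟩ : ℂ) - ρ)
    simp only [sub_im] at h4
    have h5 := h3.trans h4
    rw [inv_le_comm₀ (lt_of_lt_of_le (by positivity) h5) (by positivity)]
    simpa using h5
  have h3 := norm_le_norm_add_norm_sub' (logDeriv riemannZeta ⟨σ, T'⟩)
    (∑ ρ ∈ Z, (zetaZeroMult ρ : ℂ) / ((⟨σ, T'⟩ : ℂ) - ρ))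
  have hn0 : 0 ≤ n := by rw [hnd]; positivity
  have h4 : n * (2 * ((Z.card:ℝ) + 1)) ≤ (8*L) * (2 * (8*L+1)) := by
    gcongr
    exact hcard.trans hn
  nlinarith

lemma good_height : ∃ C : ℝ, 0 < C ∧ ∀ T : ℝ, 3 ≤ T → ∃ T' ∈ Icc T (T+1), ∀ σ ∈ Icc (-1:ℝ) 2,
    riemannZeta ⟨σ, T'⟩ ≠ 0 ∧ ‖logDeriv riemannZeta ⟨σ, T'⟩‖ ≤ C * T := by
  refine ⟨|feC| + 2000000 + 10, by positivity, fun T hT => ?_⟩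
  obtain ⟨T', hT', hg⟩ := good_right hT
  refine ⟨T', hT', fun σ hσ => ?_⟩
  have hf0 := abs_nonneg feC
  by_cases h : 1/2 ≤ σ
  · obtain ⟨h1, h2⟩ := hg σ ⟨h, hσ.2⟩
    refine ⟨h1, h2.trans ?_⟩
    gcongr
    linarith
  · push Not at h
    obtain ⟨h1, h2⟩ := hg (1-σ) ⟨by linarith, by linarith [hσ.1]⟩
    set w : ℂ := ⟨1-σ, -T'⟩ with hw
    have hwc : w = (starRingEnd ℂ) (⟨1-σ, T'⟩ : ℂ) := by
      apply Complex.ext <;> simp [hw]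
    have hs : (⟨σ, T'⟩ : ℂ) = 1 - w := by
      apply Complex.ext <;> simp [hw]
    have hTpos : 3 ≤ T' := hT.trans hT'.1
    have hne1 : (⟨1-σ, T'⟩ : ℂ) ≠ 1 := by
      intro h; have := congrArg Complex.im h; simp at this; linarith
    have hwz : riemannZeta w ≠ 0 := by
      rw [hwc, riemannZeta_conj]; simpa using h1
    have hwl : ‖logDeriv riemannZeta w‖ ≤ 2000000 * T := by
      rw [hwc, zeta_conj_logDeriv _ hne1, RCLike.norm_conj]; exact h2
    obtain ⟨f1, f2⟩ := fe_bound (w := w) (by simp [hw]; linarith)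
      (by simp [hw]; rw [abs_of_pos (by linarith)]; linarith) hwz
    rw [hs]
    refine ⟨f1, ?_⟩
    have hlog : ‖Complex.log w‖ ≤ T + 7 := by
      have h3 : ‖Complex.log w‖ ≤ |(Complex.log w).re| + |(Complex.log w).im| :=
        Complex.norm_le_abs_re_add_abs_im _
      rw [Complex.log_re, Complex.log_im] at h3
      have h4 := Complex.abs_arg_le_pi w
      have h5 : 1 ≤ ‖w‖ := by
        refine le_trans ?_ (Complex.abs_im_le_norm w)
        simp [hw]; rw [abs_of_pos (by linarith)]; linarith
      have h6 : ‖w‖ ≤ 2 + T' := by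
        refine (Complex.norm_le_abs_re_add_abs_im w).trans ?_
        simp only [hw, abs_neg]
        rw [abs_of_pos (by linarith), abs_of_pos (by linarith)]
        linarith [hσ.1]
      rw [abs_of_nonneg (Real.log_nonneg h5)] at h3
      have h7 := Real.log_le_sub_one_of_pos (by linarith : 0 < ‖w‖)
      have := Real.pi_lt_four
      linarith [hT'.2]
    have e : logDeriv riemannZeta (1-w) = (logDeriv riemannZeta (1-w) + logDeriv riemannZeta w
      + Complex.log w) - logDeriv riemannZeta w - Complex.log w := by ring
    rw [e]
    refine (norm_sub_le _ _).trans ?_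
    have h8 := norm_sub_le (logDeriv riemannZeta (1-w) + logDeriv riemannZeta w
      + Complex.log w) (logDeriv riemannZeta w)
    have h9 := le_abs_self feC
    nlinarith
end Rad

namespace Rad
open Topology

/-- Boundary integral over the rectangle `[-1,2] × [a,b]`. -/
noncomputable def rect (a b : ℝ) (F : ℂ → ℂ) : ℂ :=
  (∫ x in (-1:ℝ)..2, F (x + a * I)) - (∫ x in (-1:ℝ)..2, F (x + b * I))
    + I * (∫ y in a..b, F ((2:ℝ) + y * I)) - I * (∫ y in a..b, F ((-1:ℝ) + y * I))

def bd (a b : ℝ) : Set ℂ := {z | z.re ∈ Icc (-1:ℝ) 2 ∧ z.im ∈ Icc a b ∧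
  (z.re = -1 ∨ z.re = 2 ∨ z.im = a ∨ z.im = b)}

lemma bd_bot {a b x : ℝ} (hab : a ≤ b) (hx : x ∈ Icc (-1:ℝ) 2) : (x + a * I : ℂ) ∈ bd a b := by
  refine ⟨by simpa using hx, by simpa using hab, by simp⟩
lemma bd_top {a b x : ℝ} (hab : a ≤ b) (hx : x ∈ Icc (-1:ℝ) 2) : (x + b * I : ℂ) ∈ bd a b := by
  refine ⟨by simpa using hx, by simpa using hab, by simp⟩
lemma bd_right {a b y : ℝ} (hy : y ∈ Icc a b) : ((2:ℝ) + y * I : ℂ) ∈ bd a b := by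
  refine ⟨by simp; norm_num, by simpa using hy, by simp⟩
lemma bd_left {a b y : ℝ} (hy : y ∈ Icc a b) : ((-1:ℝ) + y * I : ℂ) ∈ bd a b := by
  refine ⟨by simp; norm_num, by simpa using hy, by simp⟩

lemma ii_bot {a b : ℝ} (hab : a ≤ b) {F : ℂ → ℂ} (hF : ContinuousOn F (bd a b)) :
    IntervalIntegrable (fun x : ℝ => F (x + a * I)) volume (-1) 2 := by
  apply ContinuousOn.intervalIntegrable
  apply hF.comp (by fun_prop)
  intro x hx
  rw [uIcc_of_le (by norm_num)] at hx
  exact bd_bot hab hx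
lemma ii_top {a b : ℝ} (hab : a ≤ b) {F : ℂ → ℂ} (hF : ContinuousOn F (bd a b)) :
    IntervalIntegrable (fun x : ℝ => F (x + b * I)) volume (-1) 2 := by
  apply ContinuousOn.intervalIntegrable
  apply hF.comp (by fun_prop)
  intro x hx
  rw [uIcc_of_le (by norm_num)] at hx
  exact bd_top hab hx
lemma ii_right {a b : ℝ} (hab : a ≤ b) {F : ℂ → ℂ} (hF : ContinuousOn F (bd a b)) :
    IntervalIntegrable (fun y : ℝ => F ((2:ℝ) + y * I)) volume a b := by
  apply ContinuousOn.intervalIntegrable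
  apply hF.comp (by fun_prop)
  intro x hx
  rw [uIcc_of_le hab] at hx
  exact bd_right hx
lemma ii_left {a b : ℝ} (hab : a ≤ b) {F : ℂ → ℂ} (hF : ContinuousOn F (bd a b)) :
    IntervalIntegrable (fun y : ℝ => F ((-1:ℝ) + y * I)) volume a b := by
  apply ContinuousOn.intervalIntegrable
  apply hF.comp (by fun_prop)
  intro x hx
  rw [uIcc_of_le hab] at hx
  exact bd_left hx

lemma rect_add {a b : ℝ} (hab : a ≤ b) {F G : ℂ → ℂ} (hF : ContinuousOn F (bd a b))
    (hG : ContinuousOn G (bd a b)) :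
    rect a b (fun z => F z + G z) = rect a b F + rect a b G := by
  unfold rect
  rw [intervalIntegral.integral_add (ii_bot hab hF) (ii_bot hab hG),
    intervalIntegral.integral_add (ii_top hab hF) (ii_top hab hG),
    intervalIntegral.integral_add (ii_right hab hF) (ii_right hab hG),
    intervalIntegral.integral_add (ii_left hab hF) (ii_left hab hG)]
  ring

lemma rect_const_mul {a b : ℝ} (c : ℂ) (F : ℂ → ℂ) :
    rect a b (fun z => c * F z) = c * rect a b F := by
  unfold rect
  simp only [intervalIntegral.integral_const_mul]
  ring

lemma rect_sum {a b : ℝ} (hab : a ≤ b) (S : Finset ℂ) {F : ℂ → ℂ → ℂ}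
    (hF : ∀ ρ ∈ S, ContinuousOn (F ρ) (bd a b)) :
    rect a b (fun z => ∑ ρ ∈ S, F ρ z) = ∑ ρ ∈ S, rect a b (F ρ) := by
  classical
  induction S using Finset.induction_on with
  | empty => simp [rect]
  | insert x S hx ih =>
    simp only [Finset.sum_insert hx]
    rw [rect_add hab (hF x (by simp)), ih (fun ρ hρ => hF ρ (by simp [hρ]))]
    apply continuousOn_finsetSum
    intro ρ hρ
    exact hF ρ (by simp [hρ])

lemma rect_congr {a b : ℝ} (hab : a ≤ b) {F G : ℂ → ℂ} (h : ∀ z ∈ bd a b, F z = G z) :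
    rect a b F = rect a b G := by
  unfold rect
  congr 1
  · congr 1
    · congr 1
      · apply intervalIntegral.integral_congr
        intro x hx
        rw [uIcc_of_le (by norm_num)] at hx
        exact h _ (bd_bot hab hx)
      · apply intervalIntegral.integral_congr
        intro x hx
        rw [uIcc_of_le (by norm_num)] at hx
        exact h _ (bd_top hab hx)
    · congr 1
      apply intervalIntegral.integral_congr
      intro x hx
      rw [uIcc_of_le hab] at hx
      exact h _ (bd_right hx)
  · congr 1
    apply intervalIntegral.integral_congr
    intro x hx
    rw [uIcc_of_le hab] at hx
    exact h _ (bd_left hx)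

lemma rect_zero {a b : ℝ} (hab : a ≤ b) {F : ℂ → ℂ}
    (hF : DifferentiableOn ℂ F {z | z.re ∈ Icc (-1:ℝ) 2 ∧ z.im ∈ Icc a b}) : rect a b F = 0 := by
  have := Complex.integral_boundary_rect_eq_zero_of_differentiableOn F ⟨-1, a⟩ ⟨2, b⟩ (by
    refine hF.mono ?_
    intro z hz
    rw [Complex.mem_reProdIm] at hz
    simp only at hz
    rw [uIcc_of_le (by norm_num), uIcc_of_le hab] at hz
    exact hz)
  simp only [smul_eq_mul] at this
  exact this

lemma log_sub_log_neg {z : ℂ} (hz : 0 < z.im) : Complex.log z - Complex.log (-z) = π * I := by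
  rw [Complex.log, Complex.log, Complex.arg_neg_eq_arg_sub_pi_of_im_pos hz, norm_neg]
  push_cast; ring

lemma rect_inv {a b : ℝ} {ρ : ℂ} (h1 : -1 < ρ.re) (h2 : ρ.re < 2) (h3 : a < ρ.im) (h4 : ρ.im < b) :
    rect a b (fun z => 1 / (z - ρ)) = 2 * π * I := by
  have hab : a ≤ b := by linarith
  have hbot : ∫ x in (-1:ℝ)..2, 1 / ((x + a * I : ℂ) - ρ)
      = Complex.log ((2:ℝ) + a * I - ρ) - Complex.log ((-1:ℝ) + a * I - ρ) := by
    apply intervalIntegral.integral_eq_sub_of_hasDerivAt (f := fun x : ℝ => Complex.log ((x:ℂ) + a * I - ρ))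
    · intro x _
      have hd : HasDerivAt (fun x : ℝ => (x:ℂ) + a * I - ρ) 1 x := by
        simpa using ((Complex.ofRealCLM.hasDerivAt (x := x)).add_const (a * I)).sub_const ρ
      exact hd.clog_real (Or.inr (by simp; intro h; linarith))
    · apply ContinuousOn.intervalIntegrable
      apply ContinuousOn.div (by fun_prop) (by fun_prop)
      intro x _ h
      have := congrArg Complex.im h
      simp at this; linarith
  have htop : ∫ x in (-1:ℝ)..2, 1 / ((x + b * I : ℂ) - ρ)
      = Complex.log ((2:ℝ) + b * I - ρ) - Complex.log ((-1:ℝ) + b * I - ρ) := by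
    apply intervalIntegral.integral_eq_sub_of_hasDerivAt (f := fun x : ℝ => Complex.log ((x:ℂ) + b * I - ρ))
    · intro x _
      have hd : HasDerivAt (fun x : ℝ => (x:ℂ) + b * I - ρ) 1 x := by
        simpa using ((Complex.ofRealCLM.hasDerivAt (x := x)).add_const (b * I)).sub_const ρ
      exact hd.clog_real (Or.inr (by simp; intro h; linarith))
    · apply ContinuousOn.intervalIntegrable
      apply ContinuousOn.div (by fun_prop) (by fun_prop)
      intro x _ h
      have := congrArg Complex.im h
      simp at this; linarith
  have hright : I * ∫ y in a..b, 1 / (((2:ℝ) + y * I : ℂ) - ρ)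
      = Complex.log ((2:ℝ) + b * I - ρ) - Complex.log ((2:ℝ) + a * I - ρ) := by
    rw [← intervalIntegral.integral_const_mul]
    apply intervalIntegral.integral_eq_sub_of_hasDerivAt (f := fun y : ℝ => Complex.log ((2:ℝ) + y * I - ρ))
    · intro y _
      have hd : HasDerivAt (fun y : ℝ => ((2:ℝ):ℂ) + y * I - ρ) I y := by
        simpa using (((Complex.ofRealCLM.hasDerivAt (x := y)).mul_const I).const_add ((2:ℝ):ℂ)).sub_const ρ
      have := hd.clog_real (Or.inl (by simp; linarith))
      exact this.congr_deriv (by ring)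
    · apply ContinuousOn.intervalIntegrable
      apply ContinuousOn.mul (by fun_prop)
      apply ContinuousOn.div (by fun_prop) (by fun_prop)
      intro x _ h
      have := congrArg Complex.re h
      simp at this; linarith
  have hleft : I * ∫ y in a..b, 1 / (((-1:ℝ) + y * I : ℂ) - ρ)
      = Complex.log (-((-1:ℝ) + b * I - ρ)) - Complex.log (-((-1:ℝ) + a * I - ρ)) := by
    rw [← intervalIntegral.integral_const_mul]
    apply intervalIntegral.integral_eq_sub_of_hasDerivAt (f := fun y : ℝ => Complex.log (-((-1:ℝ) + y * I - ρ)))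
    · intro y _
      have hd : HasDerivAt (fun y : ℝ => -(((-1:ℝ):ℂ) + y * I - ρ)) (-I) y := by
        simpa using ((((Complex.ofRealCLM.hasDerivAt (x := y)).mul_const I).const_add ((-1:ℝ):ℂ)).sub_const ρ).fun_neg
      have := hd.clog_real (Or.inl (by simp; linarith))
      refine this.congr_deriv ?_
      rw [neg_div_neg_eq]; ring
    · apply ContinuousOn.intervalIntegrable
      apply ContinuousOn.mul (by fun_prop)
      apply ContinuousOn.div (by fun_prop) (by fun_prop)
      intro x _ h
      have := congrArg Complex.re h
      simp at this; linarith
  unfold rect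
  rw [hbot, htop, hright, hleft]
  have e1 := log_sub_log_neg (z := (-1:ℝ) + b * I - ρ) (by simp; linarith)
  have e2 := log_sub_log_neg (z := -((-1:ℝ) + a * I - ρ)) (by simp; linarith)
  rw [neg_neg] at e2
  linear_combination e1 + e2

lemma rect_exp_inv {a b : ℝ} {ρ : ℂ} (β : ℝ) (h1 : -1 < ρ.re) (h2 : ρ.re < 2) (h3 : a < ρ.im)
    (h4 : ρ.im < b) :
    rect a b (fun z => Complex.exp (β * z) / (z - ρ)) = 2 * π * I * Complex.exp (β * ρ) := by
  have hab : a ≤ b := by linarith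
  set E : ℂ → ℂ := fun z => Complex.exp (β * z) with hE
  have hEd : Differentiable ℂ E := by rw [hE]; fun_prop
  have hds : Differentiable ℂ (dslope E ρ) := by
    rw [← differentiableOn_univ, Complex.differentiableOn_dslope univ_mem]
    exact hEd.differentiableOn
  have hne : ∀ z ∈ bd a b, z - ρ ≠ 0 := by
    intro z hz h
    rw [sub_eq_zero] at h
    rw [h] at hz
    rcases hz.2.2 with h | h | h | h <;> linarith
  rw [rect_congr hab (G := fun z => dslope E ρ z + E ρ * (1 / (z - ρ)))]
  · rw [rect_add hab hds.continuous.continuousOn, rect_zero hab hds.differentiableOn, rect_const_mul,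
      rect_inv h1 h2 h3 h4]
    · simp only [hE]; ring
    · apply ContinuousOn.mul continuousOn_const
      apply ContinuousOn.div continuousOn_const (by fun_prop) hne
  · intro z hz
    have hz' : z ≠ ρ := sub_ne_zero.mp (hne z hz)
    rw [dslope_of_ne _ hz', slope_def_field]
    field_simp
    ring

/-- Argument principle for the zeta function on `[-1,2] × [a,b]`. -/
lemma arg_principle {a b : ℝ} (ha : 1 ≤ a) (hab : a ≤ b) (β : ℝ)
    (hbot : ∀ σ ∈ Icc (-1:ℝ) 2, riemannZeta ⟨σ, a⟩ ≠ 0)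
    (htop : ∀ σ ∈ Icc (-1:ℝ) 2, riemannZeta ⟨σ, b⟩ ≠ 0) (Z : Finset ℂ)
    (hZ : ∀ z, z ∈ Z ↔ riemannZeta z = 0 ∧ z.re ∈ Icc (-1:ℝ) 2 ∧ z.im ∈ Icc a b) :
    rect a b (fun z => logDeriv riemannZeta z * Complex.exp (β * z))
      = 2 * π * I * ∑ ρ ∈ Z, (zetaZeroMult ρ : ℂ) * Complex.exp (β * ρ) ∧
    ContinuousOn (fun z => logDeriv riemannZeta z * Complex.exp (β * z)) (bd a b) := by
  have hne1 : ∀ z : ℂ, z.im ∈ Icc a b → z ≠ 1 := by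
    intro z hz h; rw [h] at hz; simp at hz; linarith [hz.1]
  have h1Z : 1 ∉ Z := by
    intro h; exact hne1 1 ((hZ 1).mp h).2.2 rfl
  obtain ⟨g, hg, hfac, hgne⟩ := factor Z h1Z
  have hbd : ∀ z ∈ bd a b, riemannZeta z ≠ 0 := by
    intro z hz
    rcases hz.2.2 with h | h | h | h
    · have hw := fe_bound (w := 1 - z) (by simp [h]; norm_num)
        (by simp; rw [abs_of_pos (by linarith [hz.2.1.1])]; linarith [hz.2.1.1])
        (riemannZeta_ne_zero_of_one_le_re (by simp [h]))
      simpa using hw.1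
    · exact riemannZeta_ne_zero_of_one_le_re (by rw [h]; norm_num)
    · rw [← h] at hbot
      exact hbot z.re hz.1
    · rw [← h] at htop
      exact htop z.re hz.1
  have hgn : ∀ z : ℂ, z.re ∈ Icc (-1:ℝ) 2 → z.im ∈ Icc a b → g z ≠ 0 := by
    intro z hz1 hz2 h0
    by_cases hzz : riemannZeta z = 0
    · exact hgne z ((hZ z).mpr ⟨hzz, hz1, hz2⟩) h0
    · apply hzz; rw [hfac z (hne1 z hz2), h0, mul_zero]
  have hzρ : ∀ z ∈ bd a b, ∀ ρ ∈ Z, z - ρ ≠ 0 := by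
    intro z hz ρ hρ h
    rw [sub_eq_zero] at h
    exact hbd z hz (h ▸ ((hZ ρ).mp hρ).1)
  have hlz : ∀ z ∈ bd a b, logDeriv riemannZeta z =
      ∑ ρ ∈ Z, (zetaZeroMult ρ : ℂ) / (z - ρ) + logDeriv g z := by
    intro z hz
    have hz1 := hne1 z hz.2.1
    have hev : riemannZeta =ᶠ[𝓝 z] fun z => (∏ ρ ∈ Z, (z - ρ)^(zetaZeroMult ρ)) * g z := by
      filter_upwards [isOpen_ne.mem_nhds hz1] with w hw using hfac w hw
    have e1 : logDeriv riemannZeta z = logDeriv (fun z => (∏ ρ ∈ Z, (z - ρ)^(zetaZeroMult ρ)) * g z) z := by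
      rw [logDeriv_apply, logDeriv_apply, hev.deriv_eq, hev.eq_of_nhds]
    rw [e1, logDeriv_mul (f := fun z => ∏ ρ ∈ Z, (z - ρ)^(zetaZeroMult ρ)) (g := g) z
      (by
        rw [Finset.prod_ne_zero_iff]
        intro ρ hρ
        exact pow_ne_zero _ (hzρ z hz ρ hρ)) (hgn z hz.1 hz.2.1) (by fun_prop)
      (hg z hz1).differentiableAt]
    congr 1
    have := logDeriv_prod (ι := ℂ) (s := Z) (f := fun ρ z => (z - ρ)^(zetaZeroMult ρ)) (x := z)
        (fun ρ hρ => pow_ne_zero _ (hzρ z hz ρ hρ)) (fun ρ hρ => by fun_prop)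
    rw [this]
    apply Finset.sum_congr rfl
    intro ρ hρ
    rw [logDeriv_fun_pow (f := fun z => z - ρ) (by fun_prop)]
    rw [logDeriv_apply]
    simp [div_eq_mul_inv]
  have hgd : DifferentiableOn ℂ (fun z => logDeriv g z * Complex.exp (β * z))
      {z | z.re ∈ Icc (-1:ℝ) 2 ∧ z.im ∈ Icc a b} := by
    intro z hz
    apply DifferentiableAt.differentiableWithinAt
    have hA := hg z (hne1 z hz.2)
    have h1 : DifferentiableAt ℂ (fun z => deriv g z / g z) z :=
      hA.deriv.differentiableAt.div hA.differentiableAt (hgn z hz.1 hz.2)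
    have h2 : DifferentiableAt ℂ (fun z : ℂ => Complex.exp (β * z)) z := by fun_prop
    exact h1.mul h2
  have hgc : ContinuousOn (fun z => logDeriv g z * Complex.exp (β * z)) (bd a b) :=
    hgd.continuousOn.mono (fun z hz => ⟨hz.1, hz.2.1⟩)
  have hterm : ∀ ρ ∈ Z, ContinuousOn
      (fun z => (zetaZeroMult ρ : ℂ) * (Complex.exp (β * z) / (z - ρ))) (bd a b) := by
    intro ρ hρ
    apply ContinuousOn.mul continuousOn_const
    apply ContinuousOn.div (by fun_prop) (by fun_prop)
    intro z hz
    exact hzρ z hz ρ hρ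
  have hsumc : ContinuousOn (fun z => ∑ ρ ∈ Z, (zetaZeroMult ρ : ℂ) * (Complex.exp (β * z) / (z - ρ)))
      (bd a b) := continuousOn_finsetSum _ hterm
  have hdec : ∀ z ∈ bd a b, logDeriv riemannZeta z * Complex.exp (β * z) =
      ∑ ρ ∈ Z, (zetaZeroMult ρ : ℂ) * (Complex.exp (β * z) / (z - ρ))
        + logDeriv g z * Complex.exp (β * z) := by
    intro z hz
    rw [hlz z hz, add_mul, Finset.sum_mul]
    congr 1
    apply Finset.sum_congr rfl
    intro ρ _
    ring
  constructor
  · rw [rect_congr hab hdec, rect_add hab hsumc hgc, rect_zero hab hgd, add_zero, rect_sum hab Z hterm,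
      Finset.mul_sum]
    apply Finset.sum_congr rfl
    intro ρ hρ
    have hr := (hZ ρ).mp hρ
    have hnb : ρ ∉ bd a b := fun h => hbd ρ h hr.1
    have hnb' : ¬ (ρ.re = -1 ∨ ρ.re = 2 ∨ ρ.im = a ∨ ρ.im = b) := fun h => hnb ⟨hr.2.1, hr.2.2, h⟩
    push Not at hnb'
    rw [rect_const_mul, rect_exp_inv β (lt_of_le_of_ne hr.2.1.1 (Ne.symm hnb'.1))
      (lt_of_le_of_ne hr.2.1.2 hnb'.2.1) (lt_of_le_of_ne hr.2.2.1 (Ne.symm hnb'.2.2.1))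
      (lt_of_le_of_ne hr.2.2.2 hnb'.2.2.2)]
    ring
  · exact (hsumc.add hgc).congr hdec
end Rad

namespace Rad
open Topology

lemma left_est : ∃ C : ℝ, 0 ≤ C ∧ ∀ y : ℝ, 3 ≤ y →
    ‖logDeriv riemannZeta (((-1:ℝ):ℂ) + y * I) + (Real.log y : ℝ)‖ ≤ C := by
  obtain ⟨C2, hC2⟩ := logDeriv_two
  refine ⟨|feC| + |C2| + (1 + π), by positivity, fun y hy => ?_⟩
  set w : ℂ := 2 - y * I with hw
  have hs : (((-1:ℝ):ℂ) + y * I) = 1 - w := by rw [hw]; push_cast; ring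
  have hwre : w.re = 2 := by simp [hw]
  have hwim : w.im = -y := by simp [hw]
  have h1 := (fe_bound (w := w) (by rw [hwre]; norm_num)
    (by rw [hwim, abs_neg, abs_of_pos (by linarith)]; linarith)
    (riemannZeta_ne_zero_of_one_le_re (by rw [hwre]; norm_num))).2
  have h2 := hC2 w hwre
  have h3 : ‖((Real.log y : ℝ):ℂ) - Complex.log w‖ ≤ 1 + π := by
    refine (Complex.norm_le_abs_re_add_abs_im _).trans ?_
    simp only [sub_re, sub_im, Complex.ofReal_re, Complex.ofReal_im, Complex.log_re, Complex.log_im,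
      zero_sub, abs_neg]
    have h4 := Complex.abs_arg_le_pi w
    have h5 : y ≤ ‖w‖ := by
      refine le_trans ?_ (Complex.abs_im_le_norm w)
      rw [hwim, abs_neg]; exact le_abs_self y
    have h6 : ‖w‖ ≤ 2 + y := by
      refine (Complex.norm_le_abs_re_add_abs_im w).trans ?_
      rw [hwre, hwim, abs_neg, abs_of_pos (by linarith), abs_of_pos (by linarith)]
    have h7 : Real.log y ≤ Real.log ‖w‖ := Real.log_le_log (by linarith) h5
    have h8 : Real.log ‖w‖ ≤ Real.log y + 1 := by
      have : Real.log ‖w‖ - Real.log y = Real.log (‖w‖ / y) := by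
        rw [Real.log_div (by linarith) (by linarith)]
      have h9 := Real.log_le_sub_one_of_pos (show 0 < ‖w‖/y by
        apply div_pos <;> linarith)
      have h10 : ‖w‖/y ≤ 2 := by rw [div_le_iff₀ (by linarith)]; linarith
      linarith
    have : |Real.log y - Real.log ‖w‖| ≤ 1 := by rw [abs_le]; constructor <;> linarith
    linarith
  rw [hs]
  have e : logDeriv riemannZeta (1-w) + ((Real.log y : ℝ):ℂ) =
      (logDeriv riemannZeta (1-w) + logDeriv riemannZeta w + Complex.log w)
        - logDeriv riemannZeta w + (((Real.log y : ℝ):ℂ) - Complex.log w) := by ring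
  rw [e]
  refine (norm_add_le _ _).trans ?_
  have := norm_sub_le (logDeriv riemannZeta (1-w) + logDeriv riemannZeta w + Complex.log w)
    (logDeriv riemannZeta w)
  have := le_abs_self feC
  have := le_abs_self C2
  linarith

noncomputable def lint (β a b : ℝ) : ℂ := ∫ y in a..b, ((Real.log y : ℝ):ℂ) * Complex.exp (β * y * I)

lemma exp_bound {β : ℝ} {z : ℂ} (hz : z.re ∈ Icc (-1:ℝ) 2) :
    ‖Complex.exp (β * z)‖ ≤ Real.exp (2 * |β|) := by
  rw [Complex.norm_exp, Complex.re_ofReal_mul]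
  apply Real.exp_le_exp.mpr
  have h2 : |β * z.re| ≤ |β| * 2 := by
    rw [abs_mul]
    gcongr
    rw [abs_le]; constructor <;> linarith [hz.1, hz.2]
  linarith [le_abs_self (β * z.re)]

lemma rect_est (β : ℝ) : ∃ a ∈ Icc (3:ℝ) 4, (∀ σ ∈ Icc (-1:ℝ) 2, riemannZeta ⟨σ, a⟩ ≠ 0) ∧
    ∃ C : ℝ, 0 ≤ C ∧ ∀ T : ℝ, 5 ≤ T → ∃ b ∈ Icc T (T+1), (∀ σ ∈ Icc (-1:ℝ) 2, riemannZeta ⟨σ, b⟩ ≠ 0) ∧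
      ∀ Z : Finset ℂ, (∀ z, z ∈ Z ↔ riemannZeta z = 0 ∧ z.re ∈ Icc (-1:ℝ) 2 ∧ z.im ∈ Icc a b) →
      ‖2 * π * I * (∑ ρ ∈ Z, (zetaZeroMult ρ : ℂ) * Complex.exp (β * ρ))
        - I * (Real.exp (-β) * lint β a b)‖ ≤ C * T := by
  obtain ⟨C1, hC1, hgood⟩ := good_height
  obtain ⟨C2, hC2⟩ := logDeriv_two
  obtain ⟨C3, hC30, hC3⟩ := left_est
  obtain ⟨a, ha, hga⟩ := hgood 3 le_rfl
  norm_num at ha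
  set E := Real.exp (2 * |β|) with hE
  have hEpos : 0 < E := Real.exp_pos _
  refine ⟨a, ha, fun σ hσ => (hga σ hσ).1, 3 * (C1 * E) + 3 * (C1 * E) + 2 * (|C2| * E) + 2 * (C3 * E),
    by positivity, fun T hT => ?_⟩
  obtain ⟨b, hb, hgb⟩ := hgood T (by linarith)
  refine ⟨b, hb, fun σ hσ => (hgb σ hσ).1, fun Z hZ => ?_⟩
  have hab : a ≤ b := by linarith [ha.2, hb.1]
  obtain ⟨hr, hcont⟩ := arg_principle (a := a) (b := b) (by linarith [ha.1]) hab β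
    (fun σ hσ => (hga σ hσ).1) (fun σ hσ => (hgb σ hσ).1) Z hZ
  rw [← hr]
  have e1 : ∀ x y : ℝ, (x + y * I : ℂ) = ⟨x, y⟩ := fun x y => by
    apply Complex.ext <;> simp
  have hbot : ‖∫ x in (-1:ℝ)..2, logDeriv riemannZeta (x + a * I) * Complex.exp (β * (x + a * I))‖
      ≤ (C1 * 3 * E) * |2 - (-1)| := by
    apply intervalIntegral.norm_integral_le_of_norm_le_const
    intro x hx
    rw [uIoc_of_le (by norm_num)] at hx
    have hx' : x ∈ Icc (-1:ℝ) 2 := ⟨hx.1.le, hx.2⟩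
    rw [norm_mul]
    have h1 := (hga x hx').2
    rw [← e1] at h1
    exact mul_le_mul h1 (exp_bound (by simpa using hx')) (norm_nonneg _) (by positivity)
  have htop : ‖∫ x in (-1:ℝ)..2, logDeriv riemannZeta (x + b * I) * Complex.exp (β * (x + b * I))‖
      ≤ (C1 * T * E) * |2 - (-1)| := by
    apply intervalIntegral.norm_integral_le_of_norm_le_const
    intro x hx
    rw [uIoc_of_le (by norm_num)] at hx
    have hx' : x ∈ Icc (-1:ℝ) 2 := ⟨hx.1.le, hx.2⟩
    rw [norm_mul]
    have h1 := (hgb x hx').2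
    rw [← e1] at h1
    exact mul_le_mul h1 (exp_bound (by simpa using hx')) (norm_nonneg _) (by positivity)
  have hright : ‖∫ y in a..b, logDeriv riemannZeta ((2:ℝ) + y * I) * Complex.exp (β * ((2:ℝ) + y * I))‖
      ≤ (|C2| * E) * |b - a| := by
    apply intervalIntegral.norm_integral_le_of_norm_le_const
    intro y _
    rw [norm_mul]
    have h1 := (hC2 ((2:ℝ) + y * I) (by simp)).trans (le_abs_self C2)
    exact mul_le_mul h1 (exp_bound (by simp; norm_num)) (norm_nonneg _) (by positivity)
  have hleft : ‖(∫ y in a..b, logDeriv riemannZeta ((-1:ℝ) + y * I) * Complex.exp (β * ((-1:ℝ) + y * I)))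
      + Real.exp (-β) * lint β a b‖ ≤ (C3 * E) * |b - a| := by
    have hlc : ContinuousOn (fun y : ℝ => ((Real.log y : ℝ):ℂ) * Complex.exp (β * y * I)) (uIcc a b) := by
      apply ContinuousOn.mul _ (by fun_prop)
      apply Complex.continuous_ofReal.comp_continuousOn
      apply Real.continuousOn_log.mono
      intro y hy
      rw [uIcc_of_le hab] at hy
      simp; linarith [ha.1, hy.1]
    rw [lint, ← intervalIntegral.integral_const_mul,
      ← intervalIntegral.integral_add (ii_left hab hcont) (hlc.intervalIntegrable.const_mul _)]
    apply intervalIntegral.norm_integral_le_of_norm_le_const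
    intro y hy
    rw [uIoc_of_le hab] at hy
    have e2 : Complex.exp (β * ((-1:ℝ) + y * I)) = Real.exp (-β) * Complex.exp (β * y * I) := by
      rw [Complex.ofReal_exp, ← Complex.exp_add]; congr 1; push_cast; ring
    have e3 : logDeriv riemannZeta ((-1:ℝ) + y * I) * Complex.exp (β * ((-1:ℝ) + y * I)) +
        Real.exp (-β) * (((Real.log y : ℝ):ℂ) * Complex.exp (β * y * I))
        = (logDeriv riemannZeta (((-1:ℝ):ℂ) + y * I) + (Real.log y : ℝ)) *
          Complex.exp (β * ((-1:ℝ) + y * I)) := by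
      rw [e2]; ring
    rw [e3, norm_mul]
    exact mul_le_mul (hC3 y (by linarith [ha.1, hy.1])) (exp_bound (by simp; norm_num)) (norm_nonneg _)
      hC30
  have hba : |b - a| ≤ T := by
    rw [abs_of_nonneg (by linarith)]; linarith [ha.1, hb.2]
  unfold rect
  set b1 := ∫ x in (-1:ℝ)..2, logDeriv riemannZeta (x + a * I) * Complex.exp (β * (x + a * I))
  set b2 := ∫ x in (-1:ℝ)..2, logDeriv riemannZeta (x + b * I) * Complex.exp (β * (x + b * I))
  set b3 := ∫ y in a..b, logDeriv riemannZeta ((2:ℝ) + y * I) * Complex.exp (β * ((2:ℝ) + y * I))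
  set b4 := ∫ y in a..b, logDeriv riemannZeta ((-1:ℝ) + y * I) * Complex.exp (β * ((-1:ℝ) + y * I))
  have e4 : b1 - b2 + I * b3 - I * b4 - I * (Real.exp (-β) * lint β a b) =
      b1 - b2 + I * b3 - I * (b4 + Real.exp (-β) * lint β a b) := by ring
  rw [e4]
  have n1 := norm_sub_le (b1 - b2 + I * b3) (I * (b4 + Real.exp (-β) * lint β a b))
  have n2 := norm_add_le (b1 - b2) (I * b3)
  have n3 := norm_sub_le b1 b2
  rw [norm_mul, Complex.norm_I, one_mul] at n1 n2
  have q1 : |(2:ℝ) - (-1)| = 3 := by norm_num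
  rw [q1] at hbot htop
  have q2 : (|C2| * E) * |b - a| ≤ (|C2| * E) * T := by gcongr
  have q3 : (C3 * E) * |b - a| ≤ (C3 * E) * T := by gcongr
  have q4 : 0 ≤ |C2| * E * T := by positivity
  have q5 : 0 ≤ C3 * E * T := by positivity
  have q6 : C1 * 3 * E ≤ C1 * T * E := by gcongr; linarith
  nlinarith

lemma lint_bound {β : ℝ} (hβ : 0 < β) {a b : ℝ} (ha : 3 ≤ a) (hab : a ≤ b) :
    ‖lint β a b‖ ≤ (3 / β) * b := by
  have hβc : ((β:ℂ) * I) ≠ 0 := by simp [hβ.ne']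
  have hpos : ∀ y ∈ uIcc a b, 0 < y := by
    intro y hy; rw [uIcc_of_le hab] at hy; linarith [hy.1]
  have hparts := intervalIntegral.integral_mul_deriv_eq_deriv_mul (a := a) (b := b)
    (u := fun y : ℝ => ((Real.log y : ℝ):ℂ)) (u' := fun y : ℝ => ((y⁻¹ : ℝ):ℂ))
    (v := fun y : ℝ => Complex.exp (β * y * I) / (β * I)) (v' := fun y : ℝ => Complex.exp (β * y * I))
    (fun y hy => (Real.hasDerivAt_log (hpos y hy).ne').ofReal_comp)
    (fun y hy => by
      have h1 : HasDerivAt (fun y : ℝ => (β:ℂ) * y * I) (β * I) y := by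
        simpa using ((Complex.ofRealCLM.hasDerivAt (x := y)).const_mul (β:ℂ)).mul_const I
      have h2 := h1.cexp.div_const (β * I)
      exact h2.congr_deriv (mul_div_cancel_right₀ _ hβc))
    (by
      apply ContinuousOn.intervalIntegrable
      apply Complex.continuous_ofReal.comp_continuousOn
      apply ContinuousOn.inv₀ continuousOn_id
      intro y hy; exact (hpos y hy).ne')
    (by apply Continuous.intervalIntegrable; fun_prop)
  unfold lint
  rw [hparts]
  have hv : ∀ y : ℝ, ‖Complex.exp (β * y * I) / (β * I)‖ = 1 / β := by
    intro y
    rw [norm_div, norm_mul, Complex.norm_I, Complex.norm_real, Real.norm_of_nonneg hβ.le, mul_one,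
      ← Complex.ofReal_mul, Complex.norm_exp_ofReal_mul_I]
  have hlog : ∀ y : ℝ, 3 ≤ y → y ≤ b → ‖((Real.log y : ℝ):ℂ)‖ ≤ b := by
    intro y h1 h2
    rw [Complex.norm_real, Real.norm_of_nonneg (Real.log_nonneg (by linarith))]
    have := Real.log_le_sub_one_of_pos (by linarith : 0 < y)
    linarith
  have hint : ‖∫ y in a..b, ((y⁻¹ : ℝ):ℂ) * (Complex.exp (β * y * I) / (β * I))‖ ≤ (1 / β) * |b - a| := by
    apply intervalIntegral.norm_integral_le_of_norm_le_const
    intro y hy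
    rw [uIoc_of_le hab] at hy
    rw [norm_mul, hv, Complex.norm_real, norm_inv, Real.norm_of_nonneg (by linarith [hy.1])]
    have : y⁻¹ ≤ 1 := inv_le_one_of_one_le₀ (by linarith [hy.1])
    have h3 : 0 ≤ 1/β := by positivity
    nlinarith
  have hba : |b - a| ≤ b := by rw [abs_of_nonneg (by linarith)]; linarith
  have n1 := norm_sub_le (((Real.log b : ℝ):ℂ) * (Complex.exp (β * b * I) / (β * I))
    - ((Real.log a : ℝ):ℂ) * (Complex.exp (β * a * I) / (β * I)))
    (∫ y in a..b, ((y⁻¹ : ℝ):ℂ) * (Complex.exp (β * y * I) / (β * I)))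
  have n2 := norm_sub_le (((Real.log b : ℝ):ℂ) * (Complex.exp (β * b * I) / (β * I)))
    (((Real.log a : ℝ):ℂ) * (Complex.exp (β * a * I) / (β * I)))
  rw [norm_mul, norm_mul, hv, hv] at n2
  have m1 : ‖((Real.log b : ℝ):ℂ)‖ * (1/β) ≤ b * (1/β) := by
    gcongr; exact hlog b (by linarith) le_rfl
  have m2 : ‖((Real.log a : ℝ):ℂ)‖ * (1/β) ≤ b * (1/β) := by
    gcongr; exact hlog a ha hab
  have m3 : (1/β) * |b - a| ≤ (1/β) * b := by gcongr
  have e : (3/β) * b = b * (1/β) + b * (1/β) + (1/β) * b := by ring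
  rw [e]
  linarith

lemma lint_zero {a b : ℝ} : lint 0 a b = ((b * Real.log b - a * Real.log a - b + a : ℝ):ℂ) := by
  unfold lint
  simp only [Complex.ofReal_zero, zero_mul, Complex.exp_zero, mul_one]
  rw [intervalIntegral.integral_ofReal, integral_log]
end Rad

namespace Rad
open Topology

lemma W_finite (T : ℝ) : (zetaZerosUpTo T).Finite := by
  refine (zeros_compact_finite ((isCompact_Icc (a := (0:ℝ)) (b := 1)).reProdIm
    (isCompact_Icc (a := (0:ℝ)) (b := T)))).subset ?_
  intro z hz
  obtain ⟨h1, h2, h3, h4, h5⟩ := hz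
  exact ⟨by rw [Complex.mem_reProdIm]; exact ⟨⟨h2.le, h3.le⟩, ⟨h4.le, h5⟩⟩, h1⟩

noncomputable def W (T : ℝ) : Finset ℂ := (W_finite T).toFinset

lemma mem_W {T : ℝ} {z : ℂ} : z ∈ W T ↔
    riemannZeta z = 0 ∧ 0 < z.re ∧ z.re < 1 ∧ 0 < z.im ∧ z.im ≤ T := by
  rw [W, Set.Finite.mem_toFinset]; rfl

noncomputable def S (β T : ℝ) : ℂ := ∑ ρ ∈ W T, (zetaZeroMult ρ : ℂ) * Complex.exp (β * ρ.im * I)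

lemma finsum_W {M : Type*} [AddCommMonoid M] (T : ℝ) (f : ℂ → M) :
    ∑ᶠ ρ ∈ zetaZerosUpTo T, f ρ = ∑ ρ ∈ W T, f ρ := by
  rw [finsum_mem_eq_finite_toFinset_sum f (W_finite T)]; rfl

lemma W_mono {T T' : ℝ} (h : T ≤ T') : W T ⊆ W T' := by
  intro z hz
  rw [mem_W] at *
  exact ⟨hz.1, hz.2.1, hz.2.2.1, hz.2.2.2.1, hz.2.2.2.2.trans h⟩

lemma RH_re (hRH : RiemannHypothesis) {z : ℂ} (hz : riemannZeta z = 0) (him : 0 < z.im) :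
    z.re = 1/2 := by
  apply hRH z hz
  · rintro ⟨n, hn⟩
    rw [hn] at him
    have : ((-2:ℂ) * ((n:ℂ) + 1)).im = 0 := by simp
    rw [this] at him; exact lt_irrefl _ him
  · intro h; rw [h] at him; simp at him

lemma norm_term (β : ℝ) (ρ : ℂ) :
    ‖(zetaZeroMult ρ : ℂ) * Complex.exp (β * ρ.im * I)‖ = (zetaZeroMult ρ : ℝ) := by
  rw [norm_mul, ← Complex.ofReal_mul, Complex.norm_exp_ofReal_mul_I, mul_one, RCLike.norm_natCast]

lemma main_est (hRH : RiemannHypothesis) (β : ℝ) : ∃ a ∈ Icc (3:ℝ) 4, ∃ C : ℝ, 0 ≤ C ∧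
    ∀ T : ℝ, 5 ≤ T → ∃ b ∈ Icc T (T+1),
      ‖S β T - ((Real.exp (-(3*β/2)) / (2*π) : ℝ) : ℂ) * lint β a b‖ ≤ C * T := by
  classical
  obtain ⟨a, ha, hza, C, hC, hest⟩ := rect_est β
  set D := Real.exp (-(β/2)) / (2*π) with hD
  have hDpos : 0 < D := by positivity
  refine ⟨a, ha, D * C + ‖S β a‖ + 10000, by positivity, fun T hT => ?_⟩
  obtain ⟨b, hb, hzb, hZ⟩ := hest T hT
  refine ⟨b, hb, ?_⟩
  have haW : W a ⊆ W b := W_mono (by linarith [ha.2, hb.1])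
  have hTW : W T ⊆ W b := W_mono hb.1
  have h1 := hZ (W b \ W a) (by
    intro z
    rw [Finset.mem_sdiff, mem_W, mem_W]
    constructor
    · rintro ⟨⟨h1, h2, h3, h4, h5⟩, h6⟩
      refine ⟨h1, ⟨by linarith, by linarith⟩, ⟨?_, h5⟩⟩
      by_contra h7
      exact h6 ⟨h1, h2, h3, h4, by linarith⟩
    · rintro ⟨h1, h2, h3⟩
      have him : 0 < z.im := by linarith [h3.1, ha.1]
      have hre := RH_re hRH h1 him
      refine ⟨⟨h1, by rw [hre]; norm_num, by rw [hre]; norm_num, him, h3.2⟩, ?_⟩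
      rintro ⟨-, -, -, -, h8⟩
      have h9 : z.im = a := le_antisymm h8 h3.1
      apply hza z.re h2
      rw [← h9]; exact h1)
  have e1 : ∑ ρ ∈ W b \ W a, (zetaZeroMult ρ : ℂ) * Complex.exp (β * ρ)
      = Real.exp (β/2) * ∑ ρ ∈ W b \ W a, (zetaZeroMult ρ : ℂ) * Complex.exp (β * ρ.im * I) := by
    rw [Finset.mul_sum]
    apply Finset.sum_congr rfl
    intro ρ hρ
    rw [Finset.mem_sdiff, mem_W] at hρ
    have hre := RH_re hRH hρ.1.1 hρ.1.2.2.2.1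
    have : Complex.exp (β * ρ) = Real.exp (β/2) * Complex.exp (β * ρ.im * I) := by
      rw [Complex.ofReal_exp, ← Complex.exp_add]
      congr 1
      conv_lhs => rw [← Complex.re_add_im ρ, hre]
      push_cast; ring
    rw [this]; ring
  have e2 : ∑ ρ ∈ W b \ W a, (zetaZeroMult ρ : ℂ) * Complex.exp (β * ρ.im * I) = S β b - S β a := by
    unfold S; rw [← Finset.sum_sdiff haW]; ring
  have e3 : ∑ ρ ∈ W b \ W T, (zetaZeroMult ρ : ℂ) * Complex.exp (β * ρ.im * I) = S β b - S β T := by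
    unfold S; rw [← Finset.sum_sdiff hTW]; ring
  have h2 : ‖S β b - S β T‖ ≤ 10000 * T := by
    rw [← e3]
    refine (norm_sum_le _ _).trans ?_
    simp only [norm_term]
    apply local_count (by linarith)
    intro ρ hρ
    rw [Finset.mem_sdiff, mem_W, mem_W] at hρ
    obtain ⟨⟨h1, h2, h3, h4, h5⟩, h6⟩ := hρ
    refine ⟨h1, RH_re hRH h1 h4, ?_, by linarith [hb.2]⟩
    by_contra h7
    exact h6 ⟨h1, h2, h3, h4, by linarith⟩
  rw [e1, e2] at h1
  have hpi : (π:ℂ) ≠ 0 := by simp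
  have hx1 : (Real.exp (β/2) : ℂ) * (Real.exp (-(β/2)) : ℝ) = 1 := by
    rw [← Complex.ofReal_mul, ← Real.exp_add]; simp
  have hx2 : (Real.exp (-(β/2)) : ℂ) * (Real.exp (-β) : ℝ) = (Real.exp (-(3*β/2)) : ℝ) := by
    rw [← Complex.ofReal_mul, ← Real.exp_add]; congr 2; ring
  have e4 : S β T - ((Real.exp (-(3*β/2)) / (2*π) : ℝ) : ℂ) * lint β a b =
      (-I * D) * (2 * π * I * (Real.exp (β/2) * (S β b - S β a)) - I * (Real.exp (-β) * lint β a b))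
      + S β a - (S β b - S β T) := by
    rw [hD]
    rw [Complex.ofReal_div, Complex.ofReal_div, ← hx2]
    push_cast at hx1 ⊢
    field_simp
    simp only [Complex.I_sq]
    linear_combination (-2 * π * (S β b - S β a)) * hx1
  rw [e4]
  have n1 := norm_sub_le ((-I * D) * (2 * π * I * (Real.exp (β/2) * (S β b - S β a))
    - I * (Real.exp (-β) * lint β a b)) + S β a) (S β b - S β T)
  have n2 := norm_add_le ((-I * D) * (2 * π * I * (Real.exp (β/2) * (S β b - S β a))
    - I * (Real.exp (-β) * lint β a b))) (S β a)
  rw [norm_mul, norm_mul, norm_neg, Complex.norm_I, one_mul, Complex.norm_real,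
    Real.norm_of_nonneg hDpos.le] at n2
  have m1 := mul_le_mul_of_nonneg_left h1 hDpos.le
  have m2 : ‖S β a‖ ≤ ‖S β a‖ * T := by
    nlinarith [norm_nonneg (S β a)]
  nlinarith

lemma S_bound (hRH : RiemannHypothesis) {β : ℝ} (hβ : 0 < β) :
    ∃ C : ℝ, 0 < C ∧ ∀ T : ℝ, 5 ≤ T → ‖S β T‖ ≤ C * T := by
  obtain ⟨a, ha, C, hC, h⟩ := main_est hRH β
  set D := Real.exp (-(3*β/2)) / (2*π) with hD
  have hDpos : 0 < D := by positivity
  refine ⟨C + D * (3/β) * 2 , by positivity, fun T hT => ?_⟩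
  obtain ⟨b, hb, h1⟩ := h T hT
  have h2 := lint_bound hβ ha.1 (by linarith [ha.2, hb.1] : a ≤ b)
  have h3 := norm_le_norm_add_norm_sub' (S β T) ((D:ℂ) * lint β a b)
  rw [norm_mul, Complex.norm_real, Real.norm_of_nonneg hDpos.le] at h3
  have h4 : D * ‖lint β a b‖ ≤ D * ((3/β) * (2*T)) := by
    gcongr
    refine h2.trans ?_
    gcongr
    linarith [hb.2]
  nlinarith

lemma S_zero (T : ℝ) : S 0 T = (zetaN T : ℂ) := by
  unfold S zetaN
  rw [finsum_W]
  push_cast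
  simp

lemma N_tendsto (hRH : RiemannHypothesis) :
    Tendsto (fun T : ℝ => (zetaN T : ℝ) / T) atTop atTop := by
  obtain ⟨a, ha, C, hC, h⟩ := main_est hRH 0
  have hlow : ∀ᶠ T : ℝ in atTop, (1/(2*π)) * (Real.log T - 2 - a * Real.log a) - C ≤ (zetaN T : ℝ)/T := by
    filter_upwards [eventually_ge_atTop 5] with T hT
    obtain ⟨b, hb, h1⟩ := h T hT
    rw [S_zero, lint_zero] at h1
    simp only [mul_zero, zero_div, neg_zero, Real.exp_zero] at h1
    rw [← Complex.ofReal_mul, ← Complex.ofReal_natCast, ← Complex.ofReal_sub, Complex.norm_real,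
      Real.norm_eq_abs, abs_le] at h1
    rw [le_div_iff₀ (by linarith)]
    have hl : T * Real.log T ≤ b * Real.log b := by
      have h2 : Real.log T ≤ Real.log b := Real.log_le_log (by linarith) hb.1
      have h3 : 0 ≤ Real.log T := Real.log_nonneg (by linarith)
      have h4 := hb.1
      nlinarith
    have hal : 0 ≤ a * Real.log a := by
      have := Real.log_nonneg (by linarith [ha.1] : 1 ≤ a)
      nlinarith [ha.1]
    have hin : (Real.log T - 2 - a * Real.log a) * T ≤ b * Real.log b - a * Real.log a - b + a := by
      have := hb.2
      nlinarith [ha.1]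
    have hp : 0 ≤ 1/(2*π) := by positivity
    have := mul_le_mul_of_nonneg_left hin hp
    nlinarith [h1.1]
  refine tendsto_atTop_mono' _ hlow ?_
  apply tendsto_atTop_add_const_right
  apply Tendsto.const_mul_atTop (by positivity)
  have e : (fun x : ℝ => Real.log x - 2 - a * Real.log a) = fun x => Real.log x + (-2 - a * Real.log a) := by
    funext x; ring
  rw [e]
  exact tendsto_atTop_add_const_right _ _ Real.tendsto_log_atTop
end Rad


namespace Rad
open Topology

lemma fourier_conv (μs : ℕ → ProbabilityMeasure UnitAddCircle) (μ : ProbabilityMeasure UnitAddCircle)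
    (h : ∀ j : ℤ, Tendsto (fun n => ∫ x, (fourier j : C(UnitAddCircle, ℂ)) x ∂(μs n : Measure UnitAddCircle))
      atTop (𝓝 (∫ x, (fourier j : C(UnitAddCircle, ℂ)) x ∂(μ : Measure UnitAddCircle)))) :
    Tendsto μs atTop (𝓝 μ) := by
  have hint : ∀ (ν : ProbabilityMeasure UnitAddCircle) (f : C(UnitAddCircle, ℂ)),
      Integrable f (ν : Measure UnitAddCircle) := fun ν f =>
    Continuous.integrable_of_hasCompactSupport f.continuous (HasCompactSupport.of_compactSpace _)
  have hspan : ∀ f ∈ Submodule.span ℂ (range (@fourier 1)),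
      Tendsto (fun n => ∫ x, f x ∂(μs n : Measure UnitAddCircle))
      atTop (𝓝 (∫ x, f x ∂(μ : Measure UnitAddCircle))) := by
    intro f hf
    induction hf using Submodule.span_induction with
    | mem x hx =>
      obtain ⟨j, rfl⟩ := hx
      exact h j
    | zero => simp
    | add f g _ _ hf hg =>
      have e : ∀ ν : ProbabilityMeasure UnitAddCircle, ∫ x, (f + g) x ∂(ν : Measure UnitAddCircle)
          = ∫ x, f x ∂(ν : Measure UnitAddCircle) + ∫ x, g x ∂(ν : Measure UnitAddCircle) := fun ν =>
        integral_add (hint ν f) (hint ν g)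
      simp only [e]
      exact hf.add hg
    | smul c f _ hf =>
      have e : ∀ ν : ProbabilityMeasure UnitAddCircle, ∫ x, (c • f) x ∂(ν : Measure UnitAddCircle)
          = c • ∫ x, f x ∂(ν : Measure UnitAddCircle) := fun ν => integral_smul c f
      simp only [e]
      exact hf.const_smul c
  rw [ProbabilityMeasure.tendsto_iff_forall_integral_rclike_tendsto ℂ]
  intro f
  have hf : f.toContinuousMap ∈ (Submodule.span ℂ (range (@fourier 1))).topologicalClosure := by
    rw [span_fourier_closure_eq_top]; trivial
  rw [← SetLike.mem_coe, Submodule.topologicalClosure_coe, Metric.mem_closure_iff] at hf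
  have hd : ∀ (ν : ProbabilityMeasure UnitAddCircle) (g : C(UnitAddCircle, ℂ)) (ε : ℝ),
      dist f.toContinuousMap g < ε → dist (∫ x, f x ∂(ν : Measure UnitAddCircle)) (∫ x, g x ∂(ν : Measure UnitAddCircle)) ≤ ε := by
    intro ν g ε hg
    have hf' : Integrable (fun x => f x) (ν : Measure UnitAddCircle) := hint ν f.toContinuousMap
    rw [dist_eq_norm, ← integral_sub hf' (hint ν g)]
    have := norm_integral_le_of_norm_le_const (μ := (ν : Measure UnitAddCircle)) (f := fun x => f x - g x) (C := ε)
      (Eventually.of_forall fun x => by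
        rw [← dist_eq_norm]
        exact (ContinuousMap.dist_apply_le_dist (f := f.toContinuousMap) (g := g) x).trans hg.le)
    simpa using this
  rw [Metric.tendsto_atTop]
  intro ε hε
  obtain ⟨g, hg, hfg⟩ := hf (ε/4) (by positivity)
  obtain ⟨N, hN⟩ := Metric.tendsto_atTop.1 (hspan g hg) (ε/4) (by positivity)
  refine ⟨N, fun n hn => ?_⟩
  have h1 := hd (μs n) g _ hfg
  have h2 := hd μ g _ hfg
  have h3 := hN n hn
  have h4 := dist_triangle4 (∫ x, f x ∂(μs n : Measure UnitAddCircle)) (∫ x, g x ∂(μs n : Measure UnitAddCircle))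
    (∫ x, g x ∂(μ : Measure UnitAddCircle)) (∫ x, f x ∂(μ : Measure UnitAddCircle))
  rw [dist_comm] at h2
  linarith

/-- the arc -/
def arc (u v : ℝ) : Set UnitAddCircle := (fun t : ℝ => (t : UnitAddCircle)) '' Ico u v

lemma coe_mem_arc {u v : ℝ} (hu : 0 ≤ u) (hv : v ≤ 1) (x : ℝ) :
    (x : UnitAddCircle) ∈ arc u v ↔ Int.fract x ∈ Ico u v := by
  have hx : ((Int.fract x : ℝ) : UnitAddCircle) = (x : UnitAddCircle) := by
    rw [← sub_eq_zero, ← AddCircle.coe_sub, AddCircle.coe_eq_zero_iff]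
    exact ⟨-⌊x⌋, by rw [Int.fract]; simp⟩
  constructor
  · rintro ⟨t, ht, hte⟩
    simp only at hte
    rw [← hx] at hte
    have := (AddCircle.coe_eq_coe_iff_of_mem_Ico (p := (1:ℝ)) (a := 0) (x := t) (y := Int.fract x)
      ⟨by linarith [ht.1], by linarith [ht.2]⟩ ⟨Int.fract_nonneg x, by linarith [Int.fract_lt_one x]⟩).1 hte
    rwa [← this]
  · intro h
    exact ⟨_, h, hx⟩

lemma measurableSet_arc (u v : ℝ) : MeasurableSet (arc u v) := by
  by_cases h : u < v
  · have hop : IsOpen ((fun t : ℝ => (t : UnitAddCircle)) '' Ioo u v) :=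
      QuotientAddGroup.isOpenMap_coe _ isOpen_Ioo
    rw [arc, ← Ioo_insert_left h, image_insert_eq]
    exact hop.measurableSet.insert _
  · simp [arc, Ico_eq_empty h]

lemma volume_singleton_circle (c : UnitAddCircle) : volume ({c} : Set UnitAddCircle) = 0 := by
  have := AddCircle.volume_closedBall 1 (x := c) 0
  simpa using this

lemma frontier_arc (u v : ℝ) : frontier (arc u v) ⊆ {(u : UnitAddCircle), (v : UnitAddCircle)} := by
  intro c hc
  have hcont : Continuous (fun t : ℝ => (t : UnitAddCircle)) := AddCircle.continuous_mk' 1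
  have hclosed : IsClosed ((fun t : ℝ => (t : UnitAddCircle)) '' Icc u v) :=
    (isCompact_Icc.image hcont).isClosed
  have hop : IsOpen ((fun t : ℝ => (t : UnitAddCircle)) '' Ioo u v) :=
    QuotientAddGroup.isOpenMap_coe _ isOpen_Ioo
  have h1 : c ∈ (fun t : ℝ => (t : UnitAddCircle)) '' Icc u v :=
    closure_minimal (image_mono Ico_subset_Icc_self) hclosed hc.1
  have h2 : c ∉ (fun t : ℝ => (t : UnitAddCircle)) '' Ioo u v := fun hh =>
    hc.2 (interior_maximal (image_mono Ioo_subset_Ico_self) hop hh)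
  obtain ⟨t, ht, rfl⟩ := h1
  rcases eq_or_lt_of_le ht.1 with h | h
  · left; rw [h]
  rcases eq_or_lt_of_le ht.2 with h' | h'
  · right; simp [h']
  exact absurd ⟨t, ⟨h, h'⟩, rfl⟩ h2

lemma volume_arc {u v : ℝ} (hu : 0 ≤ u) (huv : u < v) (hv : v ≤ 1) :
    volume (arc u v) = ENNReal.ofReal (v - u) := by
  rw [← (UnitAddCircle.measurePreserving_mk 0).measure_preimage (measurableSet_arc u v).nullMeasurableSet,
    Measure.restrict_apply' measurableSet_Ioc]
  apply le_antisymm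
  · calc _ ≤ volume (Ico u v ∪ {1}) := by
          apply measure_mono
          rintro t ⟨ht, ht0, ht1⟩
          rcases eq_or_lt_of_le ht1 with h | h
          · right; simpa using h
          left
          have := (coe_mem_arc hu hv t).1 ht
          rwa [Int.fract_eq_self.2 ⟨ht0.le, by linarith⟩] at this
      _ ≤ volume (Ico u v) + volume ({1} : Set ℝ) := measure_union_le _ _
      _ = _ := by simp
  · calc _ = volume (Ioo u v) := by simp
      _ ≤ _ := by
          apply measure_mono
          rintro t ⟨ht0, ht1⟩
          exact ⟨⟨t, ⟨ht0.le, ht1⟩, rfl⟩, by linarith, by linarith⟩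

/-- the empirical measure of the first `N+1` points -/
noncomputable def emp (x : ℕ → ℝ) (N : ℕ) : Measure UnitAddCircle :=
  ((N + 1 : ℕ) : ENNReal)⁻¹ • ∑ n ∈ Finset.range (N + 1), Measure.dirac (x n : UnitAddCircle)

instance emp_prob (x : ℕ → ℝ) (N : ℕ) : IsProbabilityMeasure (emp x N) := by
  constructor
  simp only [emp, Measure.smul_apply, Measure.coe_finset_sum, Finset.sum_apply, measure_univ,
    Finset.sum_const, Finset.card_range, smul_eq_mul, nsmul_eq_mul, mul_one]
  exact ENNReal.inv_mul_cancel (by simp) (by simp)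

instance vol_prob : IsProbabilityMeasure (volume : Measure UnitAddCircle) := by
  constructor
  have := AddCircle.measure_univ 1
  simpa using this

lemma emp_integral (x : ℕ → ℝ) (N : ℕ) (f : C(UnitAddCircle, ℂ)) :
    ∫ y, f y ∂(emp x N) = (∑ n ∈ Finset.range (N+1), f (x n)) / ((N + 1 : ℕ) : ℂ) := by
  rw [emp, integral_smul_measure, integral_finsetSum_measure]
  · simp only [integral_dirac]
    rw [ENNReal.toReal_inv, ENNReal.toReal_natCast, Complex.real_smul]
    push_cast
    field_simp
  · intro i _
    exact Continuous.integrable_of_hasCompactSupport f.continuous (HasCompactSupport.of_compactSpace _)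

lemma vol_integral_fourier (j : ℤ) (hj : j ≠ 0) :
    ∫ y, (fourier j : C(UnitAddCircle, ℂ)) y = 0 := by
  have h := orthonormal_fourier (T := (1:ℝ))
  have : ∫ y, (fourier j : C(UnitAddCircle, ℂ)) y ∂AddCircle.haarAddCircle = 0 := 
    integral_eq_zero_of_add_right_eq_neg (μ := AddCircle.haarAddCircle) (fun x => fourier_add_half_inv_index hj one_pos x)
  rw [AddCircle.integral_haarAddCircle] at this
  simpa using this

lemma weyl (x : ℕ → ℝ)
    (h : ∀ j : ℕ, 0 < j → Tendsto (fun N : ℕ => (∑ n ∈ Finset.range N,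
      Complex.exp (2 * π * I * j * x n)) / (N : ℂ)) atTop (𝓝 0))
    {u v : ℝ} (hu : 0 ≤ u) (huv : u < v) (hv : v ≤ 1) :
    Tendsto (fun N : ℕ => (Nat.card {n : ℕ | n < N ∧ Int.fract (x n) ∈ Ico u v} : ℝ) / N)
      atTop (𝓝 (v - u)) := by
  let μs : ℕ → ProbabilityMeasure UnitAddCircle := fun N => ⟨emp x N, emp_prob x N⟩
  let μ : ProbabilityMeasure UnitAddCircle := ⟨volume, vol_prob⟩
  have hpos : ∀ j : ℕ, 0 < j → Tendsto (fun N : ℕ => (∑ n ∈ Finset.range (N+1),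
      (fourier (j:ℤ) : C(UnitAddCircle, ℂ)) (x n)) / ((N + 1 : ℕ) : ℂ)) atTop (𝓝 0) := by
    intro j hj
    refine ((tendsto_add_atTop_iff_nat 1).2 (h j hj)).congr fun N => ?_
    congr 1
    refine Finset.sum_congr rfl fun n _ => ?_
    rw [fourier_coe_apply]
    simp
  have hconv : Tendsto μs atTop (𝓝 μ) := by
    apply fourier_conv
    intro j
    change Tendsto (fun n => ∫ y, (fourier j : C(UnitAddCircle, ℂ)) y ∂(emp x n)) atTop
      (𝓝 (∫ y, (fourier j : C(UnitAddCircle, ℂ)) y))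
    simp only [emp_integral]
    rcases lt_trichotomy j 0 with hj | hj | hj
    · rw [vol_integral_fourier j hj.ne]
      have := hpos (-j).toNat (by omega)
      rw [Int.toNat_of_nonneg (by omega)] at this
      have h2 := (Complex.continuous_conj.tendsto 0).comp this
      rw [map_zero] at h2
      refine h2.congr fun N => ?_
      simp only [Function.comp_apply, map_div₀, map_sum, map_natCast]
      congr 1
      refine Finset.sum_congr rfl fun n _ => ?_
      rw [← fourier_neg, neg_neg]
    · subst hj
      simp only [fourier_zero, Finset.sum_const, Finset.card_range, nsmul_eq_mul, mul_one]
      have : ∀ n : ℕ, ((n + 1 : ℕ) : ℂ) / ((n + 1 : ℕ) : ℂ) = 1 := fun n =>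
        div_self (by exact_mod_cast Nat.succ_ne_zero n)
      simp only [this]
      simp
    · rw [vol_integral_fourier j hj.ne']
      have := hpos j.toNat (by omega)
      rwa [Int.toNat_of_nonneg (by omega)] at this
  have hfr : (μ : Measure UnitAddCircle) (frontier (arc u v)) = 0 := by
    refine measure_mono_null (frontier_arc u v) ?_
    refine (measure_union_null (volume_singleton_circle _) (volume_singleton_circle _))
  have key := ProbabilityMeasure.tendsto_measure_of_null_frontier_of_tendsto' hconv hfr
  have key2 := (ENNReal.tendsto_toReal (measure_ne_top _ _)).comp key
  rw [← tendsto_add_atTop_iff_nat 1]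
  have hv' : ((μ : Measure UnitAddCircle) (arc u v)).toReal = v - u := by
    change (volume (arc u v)).toReal = _
    rw [volume_arc hu huv hv, ENNReal.toReal_ofReal (by linarith)]
  rw [hv'] at key2
  refine key2.congr fun N => ?_
  change ((emp x N) (arc u v)).toReal = _
  classical
  have hs : {n : ℕ | n < N + 1 ∧ Int.fract (x n) ∈ Ico u v} =
      ((Finset.range (N+1)).filter (fun n => Int.fract (x n) ∈ Ico u v) : Finset ℕ) := by
    ext n; simp
  rw [hs]
  simp only [Nat.card_eq_fintype_card, Fintype.card_coe, SetLike.coe_sort_coe]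
  rw [Finset.card_filter]
  simp only [emp, Measure.smul_apply, Measure.coe_finset_sum, Finset.sum_apply, smul_eq_mul,
    ENNReal.toReal_mul, ENNReal.toReal_inv, ENNReal.toReal_natCast]
  rw [ENNReal.toReal_sum (fun _ _ => measure_ne_top _ _), div_eq_inv_mul]
  congr 1
  push_cast
  refine Finset.sum_congr rfl fun n _ => ?_
  rw [Measure.dirac_apply' _ (measurableSet_arc u v), Set.indicator_apply]
  simp only [coe_mem_arc hu hv]
  split_ifs <;> simp
end Rad


namespace Rad
open Topology

lemma zetaN_W (T : ℝ) : zetaN T = ∑ ρ ∈ W T, zetaZeroMult ρ := by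
  unfold zetaN
  rw [finsum_W]

lemma zetaN_small : ∃ δ : ℝ, 0 < δ ∧ W δ = ∅ := by
  have h1 : ∀ᶠ δ : ℝ in 𝓝[>] 0, ∀ ρ ∈ W 1, δ < ρ.im := by
    rw [Filter.eventually_all_finset]
    intro ρ hρ
    exact (Iio_mem_nhds (mem_W.1 hρ).2.2.2.1 : Iio ρ.im ∈ 𝓝 (0:ℝ)) |> mem_nhdsWithin_of_mem_nhds
  have h2 : ∀ᶠ δ : ℝ in 𝓝[>] 0, δ < 1 := mem_nhdsWithin_of_mem_nhds (Iio_mem_nhds one_pos)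
  obtain ⟨δ, h1, h2, h3⟩ := (h1.and (h2.and self_mem_nhdsWithin)).exists
  refine ⟨δ, h3, ?_⟩
  rw [Finset.eq_empty_iff_forall_notMem]
  intro ρ hρ
  have := h1 ρ (W_mono h2.le hρ)
  have := (mem_W.1 hρ).2.2.2.2
  linarith

lemma zetaN_step (hRH : RiemannHypothesis) {T : ℝ} (hT : 4 ≤ T) :
    (zetaN T : ℝ) ≤ zetaN (T - 1) + 10000 * T := by
  classical
  have h1 : zetaN T = ∑ ρ ∈ W T \ W (T-1), zetaZeroMult ρ + zetaN (T-1) := by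
    rw [zetaN_W, zetaN_W, Finset.sum_sdiff (W_mono (by linarith))]
  have h2 := local_count (T := T - 1) (by linarith) (W T \ W (T-1)) (by
    intro ρ hρ
    rw [Finset.mem_sdiff, mem_W, mem_W] at hρ
    obtain ⟨⟨a, b, c, d, e⟩, f⟩ := hρ
    refine ⟨a, RH_re hRH a d, ?_, by linarith⟩
    by_contra! hh
    exact f ⟨a, b, c, d, hh.le⟩)
  rw [h1]
  push_cast
  linarith

section seq
variable {γs : ℕ → ℝ}

lemma seq_finite (hRH : RiemannHypothesis)
    (h : ∀ T : ℝ, 0 < T → zetaN T = Nat.card {n : ℕ | γs n ≤ T}) (T : ℝ) :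
    {n : ℕ | γs n ≤ T}.Finite := by
  by_contra hinf
  obtain ⟨T', h1, h2, h3⟩ := (((N_tendsto hRH).eventually_gt_atTop 0).and
    ((eventually_ge_atTop T).and (eventually_gt_atTop 0))).exists
  have : {n : ℕ | γs n ≤ T'}.Infinite := Set.Infinite.mono (fun n hn => le_trans hn h2) hinf
  rw [h T' h3] at h1
  have e : Nat.card {n : ℕ | γs n ≤ T'} = 0 := by
    haveI := this.to_subtype
    exact Nat.card_eq_zero_of_infinite
  rw [e] at h1
  simp at h1

lemma seq_card (hRH : RiemannHypothesis)
    (h : ∀ T : ℝ, 0 < T → zetaN T = Nat.card {n : ℕ | γs n ≤ T}) {T : ℝ} (hT : 0 < T) :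
    (seq_finite hRH h T).toFinset.card = zetaN T := by
  rw [h T hT, Nat.card_coe_set_eq, Set.ncard_eq_toFinset_card _ (seq_finite hRH h T)]

lemma seq_pos (hRH : RiemannHypothesis)
    (h : ∀ T : ℝ, 0 < T → zetaN T = Nat.card {n : ℕ | γs n ≤ T}) (n : ℕ) : 0 < γs n := by
  obtain ⟨δ, hδ, hW⟩ := zetaN_small
  by_contra! hn
  have h1 := seq_card hRH h hδ
  rw [zetaN_W, hW, Finset.sum_empty, Finset.card_eq_zero] at h1
  have : n ∈ (seq_finite hRH h δ).toFinset := by simp; linarith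
  rw [h1] at this
  simp at this

lemma seq_measure (hRH : RiemannHypothesis)
    (h : ∀ T : ℝ, 0 < T → zetaN T = Nat.card {n : ℕ | γs n ≤ T}) {T : ℝ} (hT : 0 < T) :
    (∑ n ∈ (seq_finite hRH h T).toFinset, Measure.dirac (γs n)) =
      ∑ ρ ∈ W T, (zetaZeroMult ρ) • Measure.dirac ρ.im := by
  classical
  apply Measure.ext_of_Iic
  intro a
  simp only [Measure.coe_finsetSum, Finset.sum_apply, Measure.smul_apply,
    Measure.dirac_apply' _ measurableSet_Iic, Set.indicator_apply, mem_Iic, Pi.one_apply]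
  by_cases ha : 0 < a
  · have hm : 0 < min a T := lt_min ha hT
    have h1 : (∑ n ∈ (seq_finite hRH h T).toFinset, if γs n ≤ a then (1:ENNReal) else 0)
        = (zetaN (min a T) : ENNReal) := by
      rw [← seq_card hRH h hm, ← Finset.sum_filter, Finset.sum_const, nsmul_eq_mul, mul_one]
      congr 2
      ext n; simp [and_comm]
    have h2 : (∑ ρ ∈ W T, zetaZeroMult ρ • if ρ.im ≤ a then (1:ENNReal) else 0)
        = (zetaN (min a T) : ENNReal) := by
      rw [zetaN_W]
      have : W (min a T) = (W T).filter (fun ρ => ρ.im ≤ a) := by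
        ext ρ; rw [Finset.mem_filter, mem_W, mem_W, le_min_iff]; tauto
      rw [this, Finset.sum_filter]
      push_cast
      refine Finset.sum_congr rfl fun ρ _ => ?_
      split_ifs <;> simp
    rw [h1, h2]
  · rw [Finset.sum_eq_zero, Finset.sum_eq_zero]
    · intro ρ hρ
      have := (mem_W.1 hρ).2.2.2.1
      rw [if_neg (by linarith)]; simp
    · intro n _
      have := seq_pos hRH h n
      rw [if_neg (by linarith)]

lemma seq_sum (hRH : RiemannHypothesis)
    (h : ∀ T : ℝ, 0 < T → zetaN T = Nat.card {n : ℕ | γs n ≤ T}) {T : ℝ} (hT : 0 < T) (β : ℝ) :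
    ∑ n ∈ (seq_finite hRH h T).toFinset, Complex.exp (β * γs n * I) = S β T := by
  have hi : ∀ a : ℝ, Integrable (fun t : ℝ => Complex.exp (β * t * I)) (Measure.dirac a) := by
    intro a
    exact integrable_dirac (by simp)
  have e := congrArg (fun μ : Measure ℝ => ∫ t, Complex.exp (β * t * I) ∂μ) (seq_measure hRH h hT)
  rw [integral_finsetSum_measure (fun i _ => hi _), integral_finsetSum_measure] at e
  · simp only [integral_dirac] at e
    rw [e]
    unfold S
    refine Finset.sum_congr rfl fun ρ _ => ?_
    rw [← Nat.cast_smul_eq_nsmul ENNReal, integral_smul_measure, integral_dirac]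
    simp
  · intro ρ _
    rw [← Nat.cast_smul_eq_nsmul ENNReal]
    exact (hi _).smul_measure (by simp)

lemma seq_avg (hRH : RiemannHypothesis) (hmono : Monotone γs)
    (h : ∀ T : ℝ, 0 < T → zetaN T = Nat.card {n : ℕ | γs n ≤ T}) {β : ℝ} (hβ : 0 < β) :
    Tendsto (fun N : ℕ => (∑ n ∈ Finset.range N, Complex.exp (β * γs n * I)) / (N : ℂ))
      atTop (𝓝 0) := by
  classical
  obtain ⟨C, hC, hS⟩ := S_bound hRH hβ
  have hγ : Tendsto γs atTop atTop := by
    apply tendsto_atTop_atTop_of_monotone hmono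
    intro b
    by_contra! hb
    have := seq_finite hRH h b
    rw [show {n : ℕ | γs n ≤ b} = univ from eq_univ_of_forall fun n => (hb n).le] at this
    exact Set.infinite_univ this
  have hr := (N_tendsto hRH).comp hγ
  have hlim : Tendsto (fun N : ℕ => (C + 10000) / ((zetaN (γs N) : ℝ) / γs N - 10000)) atTop (𝓝 0) := by
    apply Tendsto.const_div_atTop
    exact tendsto_atTop_add_const_right _ (-10000) hr
  apply squeeze_zero_norm' _ hlim
  filter_upwards [hγ.eventually_ge_atTop 5, hr.eventually_gt_atTop 10000] with N h5 hN
  set T := γs N with hT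
  have hT0 : 0 < T := by linarith
  simp only [Function.comp_apply] at hN
  set F := (seq_finite hRH h T).toFinset with hF
  have hsub : Finset.range N ⊆ F := by
    intro n hn
    rw [hF, Set.Finite.mem_toFinset]
    exact hmono (Finset.mem_range.1 hn).le
  have hcard : ((F \ Finset.range N).card : ℝ) ≤ 10000 * T := by
    have hT1 : 0 < T - 1 := by linarith
    have hd : Disjoint (F \ Finset.range N) (seq_finite hRH h (T-1)).toFinset := by
      rw [Finset.disjoint_left]
      intro n hn hn'
      rw [Set.Finite.mem_toFinset] at hn'
      rw [Finset.mem_sdiff, Finset.mem_range, not_lt] at hn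
      have := hmono hn.2
      simp only [mem_setOf_eq] at hn'
      linarith
    have hs : (F \ Finset.range N) ∪ (seq_finite hRH h (T-1)).toFinset ⊆ F := by
      apply Finset.union_subset Finset.sdiff_subset
      intro n hn
      rw [Set.Finite.mem_toFinset] at hn ⊢
      simp only [mem_setOf_eq] at hn ⊢
      linarith
    have := Finset.card_le_card hs
    rw [Finset.card_union_of_disjoint hd, seq_card hRH h hT1, seq_card hRH h hT0] at this
    have h2 := zetaN_step hRH (T := T) (by linarith)
    have h3 : ((F \ Finset.range N).card : ℝ) + zetaN (T-1) ≤ zetaN T := by exact_mod_cast this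
    linarith
  have hNlow : (zetaN T : ℝ) - 10000 * T ≤ N := by
    have h1 := Finset.card_sdiff_add_card_eq_card hsub
    rw [Finset.card_range, seq_card hRH h hT0] at h1
    have : ((F \ Finset.range N).card : ℝ) + N = zetaN T := by exact_mod_cast h1
    linarith
  have hnum : ‖∑ n ∈ Finset.range N, Complex.exp (β * γs n * I)‖ ≤ (C + 10000) * T := by
    have h1 := Finset.sum_sdiff (f := fun n => Complex.exp (β * γs n * I)) hsub
    rw [seq_sum hRH h hT0] at h1
    have h2 : ‖∑ n ∈ F \ Finset.range N, Complex.exp (β * γs n * I)‖ ≤ 10000 * T := by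
      refine (norm_sum_le _ _).trans (le_trans (le_of_eq ?_) hcard)
      have : ∀ n, ‖Complex.exp (β * γs n * I)‖ = 1 := fun n => by
        rw [← Complex.ofReal_mul, Complex.norm_exp_ofReal_mul_I]
      simp [this]
    have h3 := hS T h5
    rw [← eq_sub_iff_add_eq'] at h1
    rw [h1]
    refine (norm_sub_le _ _).trans ?_
    linarith
  have hden : (zetaN T : ℝ) / T - 10000 = ((zetaN T : ℝ) - 10000 * T) / T := by
    field_simp
  have hden0 : 0 < (zetaN T : ℝ) - 10000 * T := by
    rw [lt_div_iff₀ hT0] at hN; linarith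
  rw [norm_div, Complex.norm_natCast, hden, div_div_eq_mul_div]
  gcongr

end seq
end Rad

/-- Rademacher's observation: on RH the fractional parts `{αγ}` are uniformly
distributed. -/
theorem rademacher_uniform_distribution (hRH : RiemannHypothesis) (α : ℝ) (hα : 0 < α)
    (j : ℕ) (hj : 0 < j) :
    (∃ C : ℝ, 0 < C ∧ ∀ᶠ T : ℝ in Filter.atTop,
      ‖∑ᶠ ρ ∈ zetaZerosUpTo T, (zetaZeroMult ρ : ℂ) *
          Complex.exp (2 * π * Complex.I * j * α * ρ.im)‖ ≤ C * T) ∧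
    ∀ γs : ℕ → ℝ, Monotone γs →
      (∀ T : ℝ, 0 < T → zetaN T = Nat.card {n : ℕ | γs n ≤ T}) →
      ∀ u v : ℝ, 0 ≤ u → u < v → v ≤ 1 →
        Filter.Tendsto (fun N : ℕ =>
            (Nat.card {n : ℕ | n < N ∧ Int.fract (α * γs n) ∈ Set.Ico u v} : ℝ) / N)
          Filter.atTop (nhds (v - u)) := by
  constructor
  · have hj' : (0:ℝ) < j := by exact_mod_cast hj
    obtain ⟨C, hC, h⟩ := Rad.S_bound hRH (β := 2 * π * j * α) (by positivity)
    refine ⟨C, hC, ?_⟩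
    filter_upwards [eventually_ge_atTop 5] with T hT
    have := h T hT
    rw [Rad.finsum_W]
    unfold Rad.S at this
    convert this using 5
    push_cast
    ring
  · intro γs hmono h u v hu huv hv
    apply Rad.weyl (fun n => α * γs n) _ hu huv hv
    intro k hk
    have hk' : (0:ℝ) < k := by exact_mod_cast hk
    have := Rad.seq_avg hRH hmono h (β := 2 * π * k * α) (by positivity)
    convert this using 5
    push_cast
    ring
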